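/- arXiv:1206.3971 — 2 statements merged into one kernel-verified Lean document; each statement's English description precedes it below -/
import Mathlib

section
/- Let (u_p)_{p>1} be a family of nodal solutions of (𝒫_p) satisfying conditions (A) and (B). Then dist(x_p⁻, ∂Ω)/ε_p → +∞ as p → +∞. -/
open MeasureTheory Real Set Filter Topology Metric

noncomputable section

/-- The Euclidean plane. -/
abbrev R2 : Type := EuclideanSpace ℝ (Fin 2)

/-- The Laplacian: sum of the two pure second directional derivatives. -/
def lap (u : R2 → ℝ) (x : R2) : ℝ :=
  ∑ i : Fin 2,
    fderiv ℝ (fun y => fderiv ℝ u y (EuclideanSpace.single i 1)) x (EuclideanSpace.single i 1)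

/-- Each point of ∂Ω has a neighborhood in which ∂Ω is the graph of a C^∞ function
(in suitable Euclidean coordinates). -/
def SmoothBoundary (Ω : Set R2) : Prop :=
  ∀ x ∈ frontier Ω, ∃ V : Set R2, IsOpen V ∧ x ∈ V ∧
    ∃ (e : R2 ≃ᵢ R2) (g : ℝ → ℝ), ContDiff ℝ (⊤ : ℕ∞) g ∧
      frontier Ω ∩ V = {y | y ∈ V ∧ e y 1 = g (e y 0)}

/-- A (classical) solution of the Lane–Emden problem `(𝒫_p)` on Ω. -/
def IsSolution (Ω : Set R2) (p : ℝ) (u : R2 → ℝ) : Prop :=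
  ContDiffOn ℝ 2 u Ω ∧ ContDiffOn ℝ 1 u (closure Ω) ∧
  (∀ x ∈ Ω, -lap u x = |u x| ^ (p - 1) * u x) ∧
  (∀ x ∈ frontier Ω, u x = 0)

/-- A nodal (sign-changing) function on Ω. -/
def IsNodal (Ω : Set R2) (u : R2 → ℝ) : Prop :=
  (∃ x ∈ Ω, 0 < u x) ∧ ∃ x ∈ Ω, u x < 0

/-- The energy functional E_p. -/
def energy (Ω : Set R2) (p : ℝ) (u : R2 → ℝ) : ℝ :=
  (1 / 2) * ∫ x in Ω, ‖gradient u x‖ ^ 2 - (1 / (p + 1)) * ∫ x in Ω, |u x| ^ (p + 1)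

/-- Condition (A): p·∫_Ω |∇u_p|² → 16πe. -/
def CondA (Ω : Set R2) (u : ℝ → R2 → ℝ) : Prop :=
  Tendsto (fun p : ℝ => p * ∫ x in Ω, ‖gradient (u p) x‖ ^ 2) atTop
    (𝓝 (16 * π * Real.exp 1))

/-- Condition (B): p·(u_p(x_p⁺) + u_p(x_p⁻)) → K for some K ≥ 0. -/
def CondB (u : ℝ → R2 → ℝ) (xp xm : ℝ → R2) : Prop :=
  ∃ K : ℝ, 0 ≤ K ∧ Tendsto (fun p : ℝ => p * (u p (xp p) + u p (xm p))) atTop (𝓝 K)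

/-- ε_p := (p·u_p(x_p⁺)^{p−1})^{−1/2}. -/
def eps (u : ℝ → R2 → ℝ) (xp : ℝ → R2) (p : ℝ) : ℝ :=
  1 / Real.sqrt (p * u p (xp p) ^ (p - 1))

/-- The rescaling z_p of u_p around x_p⁺. -/
def zp (u : ℝ → R2 → ℝ) (xp : ℝ → R2) (p : ℝ) (x : R2) : ℝ :=
  (p / u p (xp p)) * (u p (eps u xp p • x + xp p) - u p (xp p))

/-- The rescaling z_p⁻ of u_p around x_p⁻ (with the scale ε_p of the maximum). -/
def zm (u : ℝ → R2 → ℝ) (xp xm : ℝ → R2) (p : ℝ) (x : R2) : ℝ :=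
  (p / u p (xp p)) * (-u p (eps u xp p • x + xm p) - u p (xp p))

/-- Convergence in C²_loc(ℝ²) of a family of functions f_i defined on sets D_i:
every compact set K is eventually contained in D_i, and on K all derivatives up to
order 2 converge uniformly. -/
def TendstoC2loc {ι : Type} (l : Filter ι) (D : ι → Set R2) (f : ι → R2 → ℝ)
    (g : R2 → ℝ) : Prop :=
  ∀ K : Set R2, IsCompact K →
    (∀ᶠ i in l, K ⊆ D i) ∧
    ∀ n : ℕ, n ≤ 2 →
      TendstoUniformlyOn (fun i x => iteratedFDeriv ℝ n (f i) x)
        (fun x => iteratedFDeriv ℝ n g x) l K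

/-- The standard bubble U(x) = −2 log(1 + |x|²/8). -/
def stdBubble (x : R2) : ℝ := -2 * Real.log (1 + ‖x‖ ^ 2 / 8)

/-- The bubble U_μ(x) = log(μ/(1 + μ|x|²/8)²). -/
def bubble (μ : ℝ) (x : R2) : ℝ := Real.log (μ / (1 + μ * ‖x‖ ^ 2 / 8) ^ 2)

/-- A C^∞ function compactly supported in S. -/
def CcSmoothIn (S : Set R2) (v : R2 → ℝ) : Prop :=
  ContDiff ℝ (⊤ : ℕ∞) v ∧ HasCompactSupport v ∧ tsupport v ⊆ S

/-- The quadratic form of the linearized operator at u. -/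
def Qform (p : ℝ) (u v : R2 → ℝ) : ℝ :=
  ∫ x, (‖gradient v x‖ ^ 2 - p * |u x| ^ (p - 1) * v x ^ 2)

/-- Morse index one hypothesis (M): for p large, the quadratic form of the linearized
operator is negative somewhere on C_c^∞ of the positive nodal domain, but is not
negative definite on any 2-dimensional subspace. -/
def MorseOne (Ω : Set R2) (u : ℝ → R2 → ℝ) : Prop :=
  ∀ᶠ p : ℝ in atTop,
    (∃ v : R2 → ℝ, CcSmoothIn {x ∈ Ω | 0 < u p x} v ∧ Qform p (u p) v < 0) ∧
    ¬ ∃ v w : R2 → ℝ, CcSmoothIn {x ∈ Ω | 0 < u p x} v ∧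
        CcSmoothIn {x ∈ Ω | 0 < u p x} w ∧
        LinearIndependent ℝ ![v, w] ∧
        ∀ a b : ℝ, ¬(a = 0 ∧ b = 0) →
          Qform p (u p) (fun x => a * v x + b * w x) < 0

/-- At a local minimum, the second derivative is nonnegative. -/
lemma second_deriv_nonneg_of_isLocalMin {f f' : ℝ → ℝ} {c a : ℝ} (hmin : IsLocalMin f a)
    (hf : ∀ᶠ s in 𝓝 a, HasDerivAt f (f' s) s) (hf' : HasDerivAt f' c a) : 0 ≤ c := by
  by_contra! hc
  have hd : deriv f =ᶠ[𝓝 a] f' := hf.mono fun s hs => hs.deriv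
  have hdd : deriv (deriv f) a = c := by rw [hd.deriv_eq, hf'.deriv]
  have hmax : IsLocalMax f a :=
    isLocalMax_of_deriv_deriv_neg (by rwa [hdd]) hmin.deriv_eq_zero hf.self_of_nhds.continuousAt
  have hconst : f =ᶠ[𝓝 a] fun _ => f a := by
    filter_upwards [hmin, hmax] with s h1 h2 using le_antisymm h2 h1
  have : deriv (deriv f) a = 0 := by
    rw [hconst.deriv.deriv_eq]
    simp
  linarith

/-- The second directional derivative of a `C²` function, seen along a line. -/
lemma ContDiffAt.hasDerivAt_line {f : R2 → ℝ} {x : R2} (hf : ContDiffAt ℝ 2 f x) (v : R2) :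
    (∀ᶠ s : ℝ in 𝓝 0, HasDerivAt (fun s : ℝ => f (x + s • v)) (fderiv ℝ f (x + s • v) v) s) ∧
    HasDerivAt (fun s : ℝ => fderiv ℝ f (x + s • v) v)
      (fderiv ℝ (fun y => fderiv ℝ f y v) x v) 0 := by
  have hline : ∀ s : ℝ, HasDerivAt (fun s : ℝ => x + s • v) v s := fun s => by
    simpa using ((hasDerivAt_id s).smul_const v).const_add x
  have hcont : Tendsto (fun s : ℝ => x + s • v) (𝓝 0) (𝓝 x) := by
    simpa using (hline 0).continuousAt.tendsto
  constructor
  · have h1 : ∀ᶠ y in 𝓝 x, ContDiffAt ℝ 2 f y := hf.eventually (by simp)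
    filter_upwards [hcont.eventually h1] with s hs
    exact (hs.differentiableAt (by simp)).hasFDerivAt.comp_hasDerivAt s (hline s)
  · have h2 : DifferentiableAt ℝ (fun y => fderiv ℝ f y v) x :=
      ((hf.fderiv_right (m := 1) (by norm_num)).differentiableAt (by simp)).clm_apply
        (differentiableAt_const v)
    have h3 := h2.hasFDerivAt
    rw [show x = x + (0 : ℝ) • v by simp] at h3
    have := h3.comp_hasDerivAt (0 : ℝ) (hline 0)
    simp only [zero_smul, add_zero] at this
    exact this

/-- Comparison of Laplacians at a local minimum of a difference. -/
lemma lap_le_lap_of_isLocalMin {f g : R2 → ℝ} {x : R2} (hf : ContDiffAt ℝ 2 f x)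
    (hg : ContDiffAt ℝ 2 g x) (hmin : IsLocalMin (fun y => f y - g y) x) :
    lap g x ≤ lap f x := by
  refine Finset.sum_le_sum fun i _ => ?_
  obtain ⟨f1, f2⟩ := hf.hasDerivAt_line (EuclideanSpace.single i 1)
  obtain ⟨g1, g2⟩ := hg.hasDerivAt_line (EuclideanSpace.single i 1)
  have hcont : Tendsto (fun s : ℝ => x + s • (EuclideanSpace.single i 1 : R2)) (𝓝 0) (𝓝 x) := by
    have : Continuous fun s : ℝ => x + s • (EuclideanSpace.single i 1 : R2) := by fun_prop
    simpa using this.tendsto 0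
  have hm : IsLocalMin (fun s : ℝ => f (x + s • (EuclideanSpace.single i 1 : R2))
      - g (x + s • (EuclideanSpace.single i 1 : R2))) 0 := by
    have := hcont.eventually hmin
    simpa [IsLocalMin, IsMinFilter] using this
  have := second_deriv_nonneg_of_isLocalMin hm
    (by filter_upwards [f1, g1] with s h1 h2 using h1.sub h2) (f2.sub g2)
  linarith

/-- The comparison principle on bounded open sets, with a strict differential inequality. -/
lemma le_of_lap_lt {D : Set R2} (hD : IsOpen D) (hb : Bornology.IsBounded D) {f g : R2 → ℝ}
    (hfc : ContinuousOn f (closure D)) (hgc : ContinuousOn g (closure D))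
    (hf : ∀ x ∈ D, ContDiffAt ℝ 2 f x) (hg : ∀ x ∈ D, ContDiffAt ℝ 2 g x)
    (hlap : ∀ x ∈ D, lap f x < lap g x) (hfr : ∀ x ∈ frontier D, g x ≤ f x) :
    ∀ x ∈ D, g x ≤ f x := by
  intro x hx
  obtain ⟨y, hy, hmin⟩ := hb.isCompact_closure.exists_isMinOn ⟨x, subset_closure hx⟩
    (hfc.sub hgc)
  have hle : f y - g y ≤ f x - g x := hmin (subset_closure hx)
  by_cases hyD : y ∈ D
  · have hloc : IsLocalMin (fun y => f y - g y) y :=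
      (hmin.on_subset subset_closure).isLocalMin (hD.mem_nhds hyD)
    exact absurd (lap_le_lap_of_isLocalMin (hf y hyD) (hg y hyD) hloc) (not_le.2 (hlap y hyD))
  · have := hfr y ⟨hy, by rwa [hD.interior_eq]⟩
    linarith

lemma fderiv_norm_sub_sq (z y : R2) (i : Fin 2) :
    fderiv ℝ (fun y : R2 => ‖y - z‖ ^ 2) y (EuclideanSpace.single i 1) = 2 * (y i - z i) := by
  have h : HasFDerivAt (fun y : R2 => ‖y - z‖ ^ 2) _ y :=
    ((hasFDerivAt_id y).sub_const z).norm_sq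
  rw [h.fderiv]
  simp [EuclideanSpace.inner_single_right]

lemma contDiff_norm_sub_sq (z : R2) : ContDiff ℝ 2 fun y : R2 => ‖y - z‖ ^ 2 :=
  (contDiff_id.sub contDiff_const).norm_sq ℝ

lemma lap_norm_sub_sq (a b : ℝ) (z x : R2) :
    lap (fun y => a * ‖y - z‖ ^ 2 + b) x = 4 * a := by
  have hd : Differentiable ℝ fun y : R2 => ‖y - z‖ ^ 2 :=
    (contDiff_norm_sub_sq z).differentiable (by simp)
  have h1 : ∀ i : Fin 2, ∀ y, fderiv ℝ (fun y : R2 => a * ‖y - z‖ ^ 2 + b) y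
      (EuclideanSpace.single i 1) = a * (2 * (y i - z i)) := fun i y => by
    rw [fderiv_add_const, fderiv_const_mul (hd y)]
    simp [fderiv_norm_sub_sq]
  have h2 : ∀ i : Fin 2, fderiv ℝ (fun y : R2 => a * (2 * (y i - z i))) x
      (EuclideanSpace.single i 1) = 2 * a := fun i => by
    have : HasFDerivAt (fun y : R2 => a * (2 * (y i - z i))) _ x :=
      ((((EuclideanSpace.proj i : R2 →L[ℝ] ℝ).hasFDerivAt (x := x)).sub_const (z i)).const_mul
        2).const_mul a
    rw [this.fderiv]
    simp
    ring
  simp only [lap, h1, h2, Fin.sum_univ_two]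
  ring

lemma lap_inv_norm_sub_sq (a b : ℝ) {z x : R2} (hx : x ≠ z) :
    lap (fun y => a * (‖y - z‖ ^ 2)⁻¹ + b) x = 4 * a / (‖x - z‖ ^ 2) ^ 2 := by
  have hd : Differentiable ℝ fun y : R2 => ‖y - z‖ ^ 2 :=
    (contDiff_norm_sub_sq z).differentiable (by simp)
  have hne : ∀ y : R2, y ≠ z → ‖y - z‖ ^ 2 ≠ 0 := fun y hy => by
    simpa [sub_eq_zero] using hy
  have h1 : ∀ i : Fin 2, ∀ y, y ≠ z → fderiv ℝ (fun y : R2 => a * (‖y - z‖ ^ 2)⁻¹ + b) y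
      (EuclideanSpace.single i 1) = -a * (2 * (y i - z i)) * ((‖y - z‖ ^ 2) ^ 2)⁻¹ :=
      fun i y hy => by
    have : HasFDerivAt (fun y : R2 => a * (‖y - z‖ ^ 2)⁻¹ + b) _ y :=
      ((((hasDerivAt_inv (hne y hy)).comp_hasFDerivAt y (hd y).hasFDerivAt)).const_mul
        a).add_const b
    rw [this.fderiv]
    simp only [_root_.smul_apply, fderiv_norm_sub_sq, smul_eq_mul]
    ring
  have h2 : ∀ i : Fin 2, fderiv ℝ (fun y : R2 => fderiv ℝ (fun y : R2 =>
      a * (‖y - z‖ ^ 2)⁻¹ + b) y (EuclideanSpace.single i 1)) x (EuclideanSpace.single i 1)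
      = -2 * a * ((‖x - z‖ ^ 2) ^ 2)⁻¹
        + 8 * a * (x i - z i) ^ 2 * ((‖x - z‖ ^ 2) ^ 3)⁻¹ := fun i => by
    have hev : (fun y : R2 => fderiv ℝ (fun y : R2 =>
      a * (‖y - z‖ ^ 2)⁻¹ + b) y (EuclideanSpace.single i 1)) =ᶠ[𝓝 x]
        fun y => -a * (2 * (y i - z i)) * ((‖y - z‖ ^ 2) ^ 2)⁻¹ := by
      filter_upwards [isOpen_ne.mem_nhds hx] with y hy using h1 i y hy
    rw [hev.fderiv_eq]
    have e1 : HasFDerivAt (fun y : R2 => -a * (2 * (y i - z i))) _ x :=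
      ((((EuclideanSpace.proj i : R2 →L[ℝ] ℝ).hasFDerivAt (x := x)).sub_const (z i)).const_mul
        2).const_mul (-a)
    have e2 : HasFDerivAt (fun y : R2 => ((‖y - z‖ ^ 2) ^ 2)⁻¹) _ x :=
      (hasDerivAt_inv (pow_ne_zero 2 (hne x hx))).comp_hasFDerivAt x
        ((hd x).hasFDerivAt.pow 2)
    have e3 := e1.mul e2
    rw [show (fun y : R2 => -a * (2 * (y i - z i)) * ((‖y - z‖ ^ 2) ^ 2)⁻¹) =
      (fun y : R2 => -a * (2 * (y i - z i))) * fun y : R2 => ((‖y - z‖ ^ 2) ^ 2)⁻¹ from rfl,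
      e3.fderiv]
    have := hne x hx
    simp [fderiv_norm_sub_sq]
    field_simp
    ring
  have h3 : ‖x - z‖ ^ 2 = (x 0 - z 0) ^ 2 + (x 1 - z 1) ^ 2 := by
    simp [EuclideanSpace.norm_sq_eq, Fin.sum_univ_two]
  have h4 := hne x hx
  simp only [lap, h2, Fin.sum_univ_two]
  generalize ‖x - z‖ ^ 2 = q at h3 h4
  field_simp
  linear_combination (-8) * a * h3

lemma IsSolution.neg_lap_abs_le {Ω : Set R2} {p M : ℝ} {u : R2 → ℝ} (hu : IsSolution Ω p u)
    (hp : 1 < p) (hM : ∀ x ∈ Ω, |u x| ≤ M) {x : R2} (hx : x ∈ Ω) :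
    |lap u x| ≤ M ^ (p - 1) * M := by
  rw [← abs_neg, hu.2.2.1 x hx, abs_mul, abs_of_nonneg (rpow_nonneg (abs_nonneg _) _)]
  have h0 : 0 ≤ M := (abs_nonneg _).trans (hM x hx)
  exact mul_le_mul (rpow_le_rpow (abs_nonneg _) (hM x hx) (by linarith)) (hM x hx)
    (abs_nonneg _) (rpow_nonneg h0 _)

/-- A priori lower bound for the amplitude of solutions. -/
lemma IsSolution.one_le_sq_mul_rpow {Ω : Set R2} (hop : IsOpen Ω) {R p M : ℝ}
    (hR : Ω ⊆ closedBall 0 R) {u : R2 → ℝ} (hu : IsSolution Ω p u) (hp : 1 < p) (hM0 : 0 < M)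
    (hM : ∀ x ∈ Ω, |u x| ≤ M) {x : R2} (hx : x ∈ Ω) (hxM : u x = M) :
    1 ≤ R ^ 2 * M ^ (p - 1) := by
  have hl : 0 < M ^ (p - 1) * M := mul_pos (rpow_pos_of_pos hM0 _) hM0
  have hcl : closure Ω ⊆ closedBall 0 R := closure_minimal hR isClosed_closedBall
  have hsq : ∀ y ∈ closure Ω, ‖y - 0‖ ^ 2 ≤ R ^ 2 := fun y hy => by
    have := mem_closedBall_iff_norm.1 (hcl hy)
    gcongr
  set l := M ^ (p - 1) * M with hldef
  have hC : ContDiff ℝ 2 fun y : R2 => -l * ‖y - 0‖ ^ 2 + l * R ^ 2 :=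
    (contDiff_const.mul (contDiff_norm_sub_sq 0)).add contDiff_const
  have key := le_of_lap_lt hop (isBounded_closedBall.subset hR)
    (f := fun y => -l * ‖y - 0‖ ^ 2 + l * R ^ 2) (g := u)
    hC.continuous.continuousOn hu.2.1.continuousOn
    (fun y _ => hC.contDiffAt) (fun y hy => hu.1.contDiffAt (hop.mem_nhds hy))
    (fun y hy => by
      have := neg_le_of_abs_le (hu.neg_lap_abs_le hp hM hy)
      rw [lap_norm_sub_sq]
      linarith)
    (fun y hy => by
      rw [hu.2.2.2 y hy]
      nlinarith [hsq y hy.1]) x hx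
  rw [hxM] at key
  have h1 : M ≤ l * R ^ 2 := by nlinarith [sq_nonneg ‖x - 0‖]
  rw [hldef] at h1
  by_contra! h
  nlinarith

/-- Quantitative boundary estimate: a solution is well above `-M` at points whose distance to an
exterior ball of radius `E` (relative to one side of a hypersurface contained in the boundary) is
comparable to `E`. -/
lemma IsSolution.lower_bound_near_boundary {Ω : Set R2} (hop : IsOpen Ω) {p M E A : ℝ}
    {u : R2 → ℝ} (hu : IsSolution Ω p u) (hp : 1 < p) (hM0 : 0 < M) (hM : ∀ x ∈ Ω, |u x| ≤ M)
    (hE : 0 < E) (hEM : p * M ^ (p - 1) * E ^ 2 = 1) (hA : 1 ≤ A) (hAp : 4 * A ^ 4 < p)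
    {h : R2 → ℝ} (hh : Continuous h) {z : R2}
    (hgraph : ∀ x ∈ ball z (2 * A * E), h x = 0 → x ∈ frontier Ω)
    (hball : ∀ x ∈ ball z E, h x ≤ 0) {x : R2} (hx : x ∈ Ω) (hhx : 0 < h x)
    (hxz : dist x z ≤ A * E) :
    3 * M / (4 * A ^ 2) ≤ u x + M := by
  have hA0 : 0 < A := by linarith
  set D : Set R2 := Ω ∩ ball z (2 * A * E) ∩ {y | 0 < h y}
  have hDo : IsOpen D := (hop.inter isOpen_ball).inter (isOpen_lt continuous_const hh)
  have hDΩ : closure D ⊆ closure Ω := closure_mono fun y hy => hy.1.1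
  have hDh : ∀ y ∈ closure D, 0 ≤ h y := fun y hy =>
    closure_minimal (fun w hw => le_of_lt hw.2) (isClosed_le continuous_const hh) hy
  have hDE : ∀ y ∈ closure D, E ≤ ‖y - z‖ := fun y hy => by
    refine closure_minimal (t := {y : R2 | E ≤ ‖y - z‖}) (fun w hw => ?_)
      (isClosed_le continuous_const (by fun_prop)) hy
    by_contra hlt
    have := hball w (mem_ball_iff_norm.2 (not_le.1 hlt))
    exact absurd hw.2 (not_lt.2 this)
  have hDR : ∀ y ∈ closure D, ‖y - z‖ ≤ 2 * A * E := fun y hy =>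
    closure_minimal (t := {y : R2 | ‖y - z‖ ≤ 2 * A * E})
      (fun w hw => (mem_ball_iff_norm.1 hw.1.2).le)
      (isClosed_le (by fun_prop) continuous_const) hy
  have hDz : ∀ y ∈ closure D, y ≠ z := fun y hy hyz => by
    have := hDE y hy
    simp [hyz] at this
    linarith
  have hlow : ∀ y ∈ closure D, y ∈ Ω → -M ≤ u y := fun y _ hy => neg_le_of_abs_le (hM y hy)
  set b : ℝ := -(M * (1 + 1 / (4 * A ^ 2))) with hb
  have hC : ∀ y ∈ closure D, ContDiffAt ℝ 2
      (fun y : R2 => M * E ^ 2 * (‖y - z‖ ^ 2)⁻¹ + b) y := fun y hy =>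
    (contDiffAt_const.mul ((contDiff_norm_sub_sq z).contDiffAt.inv
      (by simpa [sub_eq_zero] using hDz y hy))).add contDiffAt_const
  have key := le_of_lap_lt hDo (isBounded_ball.subset fun y hy => hy.1.2)
    (f := u) (g := fun y => M * E ^ 2 * (‖y - z‖ ^ 2)⁻¹ + b)
    (hu.2.1.continuousOn.mono hDΩ)
    (fun y hy => (hC y hy).continuousAt.continuousWithinAt)
    (fun y hy => hu.1.contDiffAt (hop.mem_nhds hy.1.1)) (fun y hy => hC y (subset_closure hy))
    (fun y hy => by
      rw [lap_inv_norm_sub_sq _ _ (hDz y (subset_closure hy))]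
      refine (le_of_abs_le (hu.neg_lap_abs_le hp hM hy.1.1)).trans_lt ?_
      have h1 := hDE y (subset_closure hy)
      have h2 := hDR y (subset_closure hy)
      have h3 : 0 < ‖y - z‖ := hE.trans_le h1
      have h4 : (‖y - z‖ ^ 2) ^ 2 ≤ 16 * A ^ 4 * E ^ 4 := by
        calc (‖y - z‖ ^ 2) ^ 2 ≤ ((2 * A * E) ^ 2) ^ 2 := by gcongr
          _ = _ := by ring
      rw [lt_div_iff₀ (by positivity)]
      have hm : 0 < M ^ (p - 1) := rpow_pos_of_pos hM0 _
      calc M ^ (p - 1) * M * (‖y - z‖ ^ 2) ^ 2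
          ≤ M ^ (p - 1) * M * (16 * A ^ 4 * E ^ 4) := by gcongr
        _ = (4 * A ^ 4) * (4 * M ^ (p - 1) * M * E ^ 4) := by ring
        _ < p * (4 * M ^ (p - 1) * M * E ^ 4) := by gcongr
        _ = (p * M ^ (p - 1) * E ^ 2) * (4 * (M * E ^ 2)) := by ring
        _ = 4 * (M * E ^ 2) := by rw [hEM, one_mul])
    (fun y hy => by
      have hyc := hy.1
      have h1 := hDE y hyc
      have h3 : 0 < ‖y - z‖ := hE.trans_le h1
      by_cases hyΩ : y ∈ Ω
      · have hyR : ‖y - z‖ = 2 * A * E := by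
          refine le_antisymm (hDR y hyc) (not_lt.1 fun hlt => ?_)
          have hyb : y ∈ ball z (2 * A * E) := mem_ball_iff_norm.2 hlt
          rcases (hDh y hyc).eq_or_lt with h0 | h0
          · have := (hgraph y hyb h0.symm).2
            rw [hop.interior_eq] at this
            exact this hyΩ
          · exact hy.2 (by rw [hDo.interior_eq]; exact ⟨⟨hyΩ, hyb⟩, h0⟩)
        refine le_trans (le_of_eq ?_) (hlow y hyc hyΩ)
        rw [hyR, hb]
        field_simp
        ring
      · rw [hu.2.2.2 y ⟨hDΩ hyc, by rwa [hop.interior_eq]⟩]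
        have h5 : E ^ 2 * (‖y - z‖ ^ 2)⁻¹ ≤ 1 := by
          rw [← div_eq_mul_inv, div_le_one (by positivity)]
          gcongr
        have h6 : 0 < M * (1 / (4 * A ^ 2)) := by positivity
        rw [hb]
        nlinarith) x ⟨⟨hx, by rw [mem_ball]; nlinarith⟩, hhx⟩
  have hxD : x ∈ closure D := subset_closure ⟨⟨hx, by rw [mem_ball]; nlinarith⟩, hhx⟩
  have h1 : 0 < ‖x - z‖ := hE.trans_le (hDE x hxD)
  have h2 : M / A ^ 2 ≤ M * E ^ 2 * (‖x - z‖ ^ 2)⁻¹ := by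
    rw [← div_eq_mul_inv, div_le_div_iff₀ (by positivity) (by positivity)]
    calc M * ‖x - z‖ ^ 2 ≤ M * (A * E) ^ 2 := by
          rw [dist_eq_norm] at hxz
          gcongr
      _ = _ := by ring
  have h3 : 3 * M / (4 * A ^ 2) = M / A ^ 2 + b + M := by
    rw [hb]
    field_simp
    ring
  linarith

/-- A point with a Lipschitz graph as boundary admits balls of comparable size and distance on
either side of the graph. -/
lemma ball_below_lipschitz_graph {g : ℝ → ℝ} {L : NNReal} {t : Set ℝ} (hg : LipschitzOnWith L g t)
    (e : R2 ≃ᵢ R2) {y : R2} (hy : e y 1 = g (e y 0)) {σ : ℝ} (hσ : |σ| = 1) {E : ℝ} (hE : 0 < E)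
    (ht : ball (e y 0) E ⊆ t) :
    ∃ z : R2, dist z y = (L + 1) * E ∧ ∀ x ∈ ball z E, σ * (e x 1 - g (e x 0)) ≤ 0 := by
  have hσ2 : σ * σ = 1 := by rw [← abs_mul_abs_self, hσ, one_mul]
  set w : R2 := e y + EuclideanSpace.single 1 (-σ * ((L + 1) * E)) with hw
  have hL : (0 : ℝ) ≤ L := L.2
  refine ⟨e.symm w, ?_, fun x hx => ?_⟩
  · rw [← e.dist_eq, e.apply_symm_apply, hw, dist_eq_norm, add_sub_cancel_left,
      PiLp.norm_single, norm_mul, norm_neg, Real.norm_eq_abs, hσ, one_mul,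
      Real.norm_of_nonneg (by positivity)]
  · have hd : ‖e x - w‖ < E := by
      rwa [mem_ball, ← e.dist_eq, e.apply_symm_apply, dist_eq_norm] at hx
    have h0 : |e x 0 - e y 0| < E := by
      have := (PiLp.norm_apply_le (e x - w) 0).trans_lt hd
      simpa [hw] using this
    have h1 : |e x 1 - e y 1 + σ * ((L + 1) * E)| < E := by
      have := (PiLp.norm_apply_le (e x - w) 1).trans_lt hd
      rw [Real.norm_eq_abs] at this
      have h5 : (e x - w) 1 = e x 1 - e y 1 + σ * ((L + 1) * E) := by
        simp [hw]
        ring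
      rwa [h5] at this
    have h2 : |g (e x 0) - g (e y 0)| ≤ L * E := by
      have := hg.dist_le_mul (e x 0) (ht (by rwa [mem_ball, Real.dist_eq])) (e y 0)
        (ht (mem_ball_self hE))
      rw [Real.dist_eq, Real.dist_eq] at this
      exact this.trans (by gcongr)
    have h3 : σ * (e x 1 - e y 1 + σ * ((L + 1) * E)) ≤ E :=
      (le_abs_self _).trans (by rw [abs_mul, hσ, one_mul]; exact h1.le)
    have h4 : -(σ * (g (e x 0) - g (e y 0))) ≤ L * E :=
      (neg_le_abs _).trans (by rw [abs_mul, hσ, one_mul]; exact h2)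
    rw [hy] at h3
    linear_combination h3 + h4 + (-(L + 1) * E) * hσ2

theorem stmt11
    (Ω : Set R2) (hne : Ω.Nonempty) (hop : IsOpen Ω)
    (hbdd : Bornology.IsBounded Ω) (hconn : IsConnected Ω) (hsm : SmoothBoundary Ω)
    (u : ℝ → R2 → ℝ)
    (hsol : ∀ p > (1:ℝ), IsSolution Ω p (u p))
    (hnod : ∀ p > (1:ℝ), IsNodal Ω (u p))
    (xp xm : ℝ → R2)
    (hxpmem : ∀ p > (1:ℝ), xp p ∈ Ω)
    (hxpmax : ∀ p > (1:ℝ), ∀ x ∈ Ω, u p x ≤ u p (xp p))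
    (hxmmem : ∀ p > (1:ℝ), xm p ∈ Ω)
    (hxmmin : ∀ p > (1:ℝ), ∀ x ∈ Ω, u p (xm p) ≤ u p x)
    (hcomp : ∀ p > (1:ℝ), -u p (xm p) ≤ u p (xp p))
    (hA : CondA Ω u) (hB : CondB u xp xm) :
    Tendsto (fun p : ℝ => Metric.infDist (xm p) (frontier Ω) / eps u xp p) atTop atTop := by
  have hM0 : ∀ p > (1:ℝ), 0 < u p (xp p) := fun p hp => by
    obtain ⟨x, hx, hpos⟩ := (hnod p hp).1
    exact hpos.trans_le (hxpmax p hp x hx)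
  have habs : ∀ p > (1:ℝ), ∀ x ∈ Ω, |u p x| ≤ u p (xp p) := fun p hp x hx =>
    abs_le.2 ⟨by linarith [hcomp p hp, hxmmin p hp x hx], hxpmax p hp x hx⟩
  obtain ⟨R, hR1, hR⟩ : ∃ R : ℝ, 1 ≤ R ∧ Ω ⊆ closedBall 0 R := by
    obtain ⟨R, hR⟩ := hbdd.subset_closedBall 0
    exact ⟨max 1 R, le_max_left _ _, hR.trans (closedBall_subset_closedBall (le_max_right _ _))⟩
  have hamp : ∀ p > (1:ℝ), 1 ≤ R ^ 2 * u p (xp p) ^ (p - 1) := fun p hp =>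
    (hsol p hp).one_le_sq_mul_rpow hop hR hp (hM0 p hp) (habs p hp) (hxpmem p hp) rfl
  have hMlow : ∀ p ≥ (2:ℝ), 1 ≤ R ^ 2 * u p (xp p) := fun p hp => by
    have hp1 : (1:ℝ) < p := by linarith
    rcases le_total (u p (xp p)) 1 with h | h
    · have h1 := rpow_le_rpow_of_exponent_ge (hM0 p hp1) h (show (1:ℝ) ≤ p - 1 by linarith)
      rw [rpow_one] at h1
      exact (hamp p hp1).trans (by gcongr)
    · nlinarith
  have heps0 : ∀ p > (1:ℝ), 0 < eps u xp p := fun p hp => by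
    have := rpow_pos_of_pos (hM0 p hp) (p - 1)
    unfold eps
    positivity
  have heps2 : ∀ p > (1:ℝ), p * u p (xp p) ^ (p - 1) * eps u xp p ^ 2 = 1 := fun p hp => by
    have := rpow_pos_of_pos (hM0 p hp) (p - 1)
    have hpos : 0 < p * u p (xp p) ^ (p - 1) := by positivity
    rw [eps, div_pow, sq_sqrt hpos.le]
    field_simp
  have heps_lim : ∀ η > (0:ℝ), ∀ᶠ p in atTop, eps u xp p < η := fun η hη => by
    filter_upwards [eventually_gt_atTop (1:ℝ), eventually_gt_atTop (R ^ 2 / η ^ 2)] with p hp hp2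
    rw [div_lt_iff₀ (by positivity)] at hp2
    have h1 := heps2 p hp
    have h2 := hamp p hp
    by_contra! h
    have h3 : η ^ 2 ≤ eps u xp p ^ 2 := by gcongr
    have hm := rpow_pos_of_pos (hM0 p hp) (p - 1)
    have h4 : p * u p (xp p) ^ (p - 1) * η ^ 2 ≤ 1 := by
      calc _ ≤ p * u p (xp p) ^ (p - 1) * eps u xp p ^ 2 := by gcongr
        _ = 1 := h1
    nlinarith
  have hfrc : IsCompact (frontier Ω) := hbdd.isCompact_closure.of_isClosed_subset
    isClosed_frontier frontier_subset_closure
  have hfrne : (frontier Ω).Nonempty := nonempty_frontier_iff.2 ⟨hne, fun h =>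
    NormedSpace.unbounded_univ ℝ R2 (h ▸ hbdd)⟩
  choose y hyfr hydist using fun p : ℝ => hfrc.exists_infDist_eq_dist hfrne (xm p)
  rw [Filter.tendsto_atTop]
  by_contra! hcon
  obtain ⟨C₀, hC₀⟩ := hcon
  set C := max C₀ 0
  set F : Filter ℝ := atTop ⊓ 𝓟 {p | infDist (xm p) (frontier Ω) / eps u xp p < C₀}
  have : F.NeBot := frequently_mem_iff_neBot.1 hC₀
  have hFle : F ≤ atTop := inf_le_left
  have hFC : ∀ᶠ p in F, infDist (xm p) (frontier Ω) ≤ C * eps u xp p := by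
    have h1 : ∀ᶠ p in F, infDist (xm p) (frontier Ω) / eps u xp p < C₀ :=
      mem_inf_of_right (mem_principal_self _)
    filter_upwards [h1, hFle (eventually_gt_atTop (1:ℝ))] with p h2 hp
    rw [div_lt_iff₀ (heps0 p hp)] at h2
    exact h2.le.trans (mul_le_mul_of_nonneg_right (le_max_left _ _) (heps0 p hp).le)
  obtain ⟨y₀, hy₀, hcl⟩ := hfrc.exists_mapClusterPt_of_frequently (l := F) (f := y)
    (Eventually.of_forall hyfr).frequently
  obtain ⟨V, hVo, hyV, e, g, hg, hgr⟩ := hsm y₀ hy₀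
  obtain ⟨L, t, ht, hL⟩ := (hg.of_le (m := 1) (by simp)).contDiffAt.exists_lipschitzOnWith
    (x := e y₀ 0)
  obtain ⟨δ₁, hδ₁, hδV⟩ := Metric.isOpen_iff.1 hVo y₀ hyV
  obtain ⟨δ₂, hδ₂, hδt⟩ := Metric.mem_nhds_iff.1 ht
  set δ := min δ₁ δ₂
  have hδ0 : 0 < δ := lt_min hδ₁ hδ₂
  set A : ℝ := C + L + 1 with hAdef
  have hC0 : 0 ≤ C := le_max_right _ _
  have hL0 : (0 : ℝ) ≤ L := L.2
  have hA1 : 1 ≤ A := by linarith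
  obtain ⟨K, hK0, hK⟩ := hB
  have hfreq : ∃ᶠ p in F, y p ∈ ball y₀ (δ / 2) :=
    mapClusterPt_iff_frequently.1 hcl _ (ball_mem_nhds _ (by positivity))
  have hall : ∀ᶠ p in F, infDist (xm p) (frontier Ω) ≤ C * eps u xp p ∧ 2 < p ∧
      4 * A ^ 4 < p ∧ 4 * A ^ 2 * R ^ 2 * (K + 1) < 3 * p ∧
      eps u xp p < δ / (2 * (2 * A + L + 1)) ∧
      p * (u p (xp p) + u p (xm p)) < K + 1 := by
    filter_upwards [hFC, hFle (eventually_gt_atTop 2), hFle (eventually_gt_atTop (4 * A ^ 4)),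
      hFle (eventually_gt_atTop (4 * A ^ 2 * R ^ 2 * (K + 1) / 3)),
      hFle (heps_lim (δ / (2 * (2 * A + L + 1))) (by positivity)),
      hFle (hK.eventually_lt_const (lt_add_one K))] with p h1 h2 h3 h4 h5 h6
    exact ⟨h1, h2, h3, by linarith, h5, h6⟩
  obtain ⟨p, hyp, hd, hp2, hpA, hpK, hE, hBp⟩ := (hfreq.and_eventually hall).exists
  have hp1 : 1 < p := by linarith
  have hE0 := heps0 p hp1
  set E := eps u xp p
  rw [lt_div_iff₀ (by positivity)] at hE
  have hLE : 0 ≤ L * E := by positivity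
  have hCE : 0 ≤ C * E := by positivity
  have hEδ : E < δ / 2 := by nlinarith
  have hyVp : y p ∈ V := hδV (ball_subset_ball (by linarith [min_le_left δ₁ δ₂]) hyp)
  have hey : e (y p) 1 = g (e (y p) 0) := by
    have : y p ∈ frontier Ω ∩ V := ⟨hyfr p, hyVp⟩
    rw [hgr] at this
    exact this.2
  have hdist0 : dist (e (y p) 0) (e y₀ 0) < δ / 2 := by
    rw [mem_ball, ← e.dist_eq, dist_eq_norm] at hyp
    rw [dist_eq_norm]
    exact (PiLp.norm_apply_le (e (y p) - e y₀) 0).trans_lt hyp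
  have htE : ball (e (y p) 0) E ⊆ t := (ball_subset_ball' (by
    linarith [min_le_right δ₁ δ₂])).trans hδt
  have hzV : ∀ z, dist z (y p) = (L + 1) * E → ball z (2 * A * E) ⊆ V := fun z hz =>
    (ball_subset_ball' (by
      have := dist_triangle z (y p) y₀
      rw [mem_ball] at hyp
      linarith [min_le_left δ₁ δ₂])).trans hδV
  have hxy : dist (xm p) (y p) ≤ C * E := (hydist p).symm.le.trans hd
  have hxV : xm p ∈ V := hδV (by
    have := dist_triangle (xm p) (y p) y₀
    rw [mem_ball] at hyp ⊢
    nlinarith [min_le_left δ₁ δ₂])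
  have hne0 : e (xm p) 1 - g (e (xm p) 0) ≠ 0 := fun h0 => by
    have : xm p ∈ frontier Ω ∩ V := by
      rw [hgr]
      exact ⟨hxV, sub_eq_zero.1 h0⟩
    have := this.1.2
    rw [hop.interior_eq] at this
    exact this (hxmmem p hp1)
  obtain ⟨σ, hσ, hσpos⟩ : ∃ σ : ℝ, |σ| = 1 ∧ 0 < σ * (e (xm p) 1 - g (e (xm p) 0)) := by
    rcases hne0.lt_or_gt with h | h
    · exact ⟨-1, by simp, by linarith⟩
    · exact ⟨1, by simp, by linarith⟩
  obtain ⟨z, hz, hzball⟩ := ball_below_lipschitz_graph hL e hey hσ hE0 htE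
  have hσ0 : σ ≠ 0 := fun h => by simp [h] at hσ
  have hcont : Continuous fun x : R2 => σ * (e x 1 - g (e x 0)) := by
    have he := e.continuous
    have hg' := hg.continuous
    fun_prop
  have key := (hsol p hp1).lower_bound_near_boundary hop hp1 (hM0 p hp1) (habs p hp1) hE0
    (heps2 p hp1) hA1 hpA hcont (z := z)
    (fun x hx h0 => by
      have : x ∈ frontier Ω ∩ V := by
        rw [hgr]
        exact ⟨hzV z hz hx, sub_eq_zero.1 ((mul_eq_zero.1 h0).resolve_left hσ0)⟩
      exact this.1)
    hzball (hxmmem p hp1) hσpos (by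
      have := dist_triangle (xm p) (y p) z
      rw [dist_comm (y p) z, hz] at this
      linarith)
  have hMl := hMlow p hp2.le
  rw [div_le_iff₀ (by positivity)] at key
  have hAR : 0 < 4 * A ^ 2 * R ^ 2 := by positivity
  have h1 : 3 * p ≤ 3 * p * (R ^ 2 * u p (xp p)) := le_mul_of_one_le_right (by linarith) hMl
  have h2 : p * R ^ 2 * (3 * u p (xp p))
      ≤ p * R ^ 2 * ((u p (xm p) + u p (xp p)) * (4 * A ^ 2)) := by gcongr
  have h3 := mul_lt_mul_of_pos_left hBp hAR
  linarith
end
end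

section
/- Let (u_p)_{p>1} be a family of nodal solutions of (𝒫_p) satisfying condition (A). Then limsup_{p→+∞} (max_Ω u_p) ≤ e^{1/2} and limsup_{p→+∞} (−min_Ω u_p) ≤ e^{1/2}. -/
open MeasureTheory Real Set Filter Topology Metric

noncomputable section

open scoped Pointwise in
/-- The one-dimensional Brunn–Minkowski inequality for compact sets. -/
theorem volume_add_le_of_isCompact {A B : Set ℝ} (hA : IsCompact A) (hB : IsCompact B)
    (hAn : A.Nonempty) (hBn : B.Nonempty) : volume A + volume B ≤ volume (A + B) := by
  obtain ⟨a, haA, ha⟩ := hA.exists_isGreatest hAn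
  obtain ⟨b, hbB, hb⟩ := hB.exists_isLeast hBn
  have h1 : (A + {b}) ∪ ({a} + B) ⊆ A + B :=
    union_subset (add_subset_add_left (singleton_subset_iff.2 hbB))
      (add_subset_add_right (singleton_subset_iff.2 haA))
  have h2 : (A + {b}) ∩ ({a} + B) ⊆ {a + b} := by
    rintro x ⟨⟨y, hy, z, hz, rfl⟩, ⟨y', hy', z', hz', h⟩⟩
    simp only [mem_singleton_iff] at hz hy' h ⊢
    have := ha hy
    have := hb hz'
    linarith
  have h3 : volume ((A + {b}) ∩ ({a} + B)) = 0 := measure_mono_null h2 (by simp)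
  have h4 := measure_union_add_inter (μ := volume) (A + {b})
    (t := {a} + B) ((isCompact_singleton.add hB).measurableSet)
  rw [h3, add_zero] at h4
  calc volume A + volume B = volume (A + {b}) + volume ({a} + B) := by
        congr 1
        · rw [add_singleton, image_add_right, measure_preimage_add_right]
        · rw [singleton_add, image_add_left, measure_preimage_add]
    _ = _ := h4.symm
    _ ≤ _ := measure_mono h1

open scoped Pointwise in
/-- The one-dimensional Brunn–Minkowski inequality. -/
theorem volume_add_le_of_measurableSet {A B C : Set ℝ} (hA : MeasurableSet A)
    (hB : MeasurableSet B) (hAn : A.Nonempty) (hBn : B.Nonempty) (hC : A + B ⊆ C) :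
    volume A + volume B ≤ volume C := by
  have key : ∀ K ⊆ A, IsCompact K → ∀ L ⊆ B, IsCompact L → volume K + volume L ≤ volume C := by
    intro K hK hKc L hL hLc
    obtain ⟨a, ha⟩ := hAn
    obtain ⟨b, hb⟩ := hBn
    calc volume K + volume L ≤ volume (insert a K) + volume (insert b L) :=
          add_le_add (measure_mono (subset_insert _ _)) (measure_mono (subset_insert _ _))
      _ ≤ volume (insert a K + insert b L) :=
          volume_add_le_of_isCompact (hKc.insert a) (hLc.insert b) (insert_nonempty _ _)
            (insert_nonempty _ _)
      _ ≤ volume C := measure_mono ((add_subset_add (insert_subset ha hK)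
          (insert_subset hb hL)).trans hC)
  rcases eq_or_ne (volume C) ⊤ with h | hfin
  · simp [h]
  have hK' : ∀ K ⊆ A, IsCompact K → volume B ≤ volume C - volume K := by
    intro K hK hKc
    rw [hB.measure_eq_iSup_isCompact]
    exact iSup_le fun L => iSup_le fun hL => iSup_le fun hLc =>
      ENNReal.le_sub_of_add_le_left hKc.measure_lt_top.ne (key K hK hKc L hL hLc)
  have hBfin : volume B ≠ ⊤ :=
    ((hK' ∅ (empty_subset _) isCompact_empty).trans_lt
      (tsub_le_self.trans_lt hfin.lt_top)).ne
  have hA' : volume A ≤ volume C - volume B := by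
    rw [hA.measure_eq_iSup_isCompact]
    refine iSup_le fun K => iSup_le fun hK => iSup_le fun hKc =>
      ENNReal.le_sub_of_add_le_right hBfin ?_
    have hKle : volume K ≤ volume C := by
      simpa using key K hK hKc ∅ (empty_subset _) isCompact_empty
    calc volume K + volume B ≤ volume K + (volume C - volume K) := by
          gcongr
          exact hK' K hK hKc
      _ = volume C := add_tsub_cancel_of_le hKle
  have hBle : volume B ≤ volume C := by
    simpa using hK' ∅ (empty_subset _) isCompact_empty
  calc volume A + volume B ≤ (volume C - volume B) + volume B := by gcongr
    _ = volume C := tsub_add_cancel_of_le hBle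

/-- Slicing bound behind the planar Brunn–Minkowski inequality. -/
theorem exists_slice_bound {A B C : Set (ℝ × ℝ)} (hA : IsOpen A) (hB : IsOpen B)
    (hC : MeasurableSet C) (hAb : Bornology.IsBounded A) (hBb : Bornology.IsBounded B)
    (hCb : Bornology.IsBounded C)
    (hAn : A.Nonempty) (hBn : B.Nonempty) (hABC : ∀ x ∈ A, ∀ y ∈ B, x + y ∈ C) :
    ∃ a b : ℝ, 0 < a ∧ 0 < b ∧
      volume.real A / a + volume.real B / b ≤ volume.real C / (a + b) := by
  let f : Set (ℝ × ℝ) → ℝ → ℝ := fun S x => volume.real (Prod.mk x ⁻¹' S)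
  have fin : ∀ S : Set (ℝ × ℝ), Bornology.IsBounded S → ∃ R : ℝ, ∀ x,
      volume (Prod.mk x ⁻¹' S) ≤ ENNReal.ofReal R := by
    intro S hS
    obtain ⟨R, hR⟩ := hS.subset_closedBall 0
    refine ⟨2 * R, fun x => ?_⟩
    rw [← Real.volume_closedBall 0 R]
    refine measure_mono fun y hy => ?_
    have := hR hy
    simp only [mem_closedBall, dist_zero_right, Prod.norm_def] at this ⊢
    exact (le_max_right _ _).trans this
  have meas : ∀ S : Set (ℝ × ℝ), MeasurableSet S → Measurable (f S) := fun S hS =>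
    (measurable_measure_prodMk_left hS).ennreal_toReal
  have ofR : ∀ S : Set (ℝ × ℝ), Bornology.IsBounded S → ∀ x,
      ENNReal.ofReal (f S x) = volume (Prod.mk x ⁻¹' S) := by
    intro S hS x
    obtain ⟨R, hR⟩ := fin S hS
    exact ENNReal.ofReal_toReal ((hR x).trans_lt ENNReal.ofReal_lt_top).ne
  have vol : ∀ S : Set (ℝ × ℝ), MeasurableSet S → Bornology.IsBounded S → ∀ c : ℝ, 0 < c →
      ENNReal.ofReal (volume.real S / c) = ∫⁻ t in Ioi (0:ℝ), volume {x | t < f S x / c} := by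
    intro S hS hSb c hc
    rw [← lintegral_eq_lintegral_meas_lt]
    · rw [div_eq_inv_mul, ENNReal.ofReal_mul (by positivity)]
      simp_rw [div_eq_inv_mul, ENNReal.ofReal_mul (inv_nonneg.2 hc.le)]
      rw [lintegral_const_mul _ (meas S hS).ennreal_ofReal]
      congr 1
      simp_rw [ofR S hSb]
      rw [measureReal_def, ENNReal.ofReal_toReal hSb.measure_lt_top.ne]
      exact Measure.prod_apply hS
    · exact Eventually.of_forall fun x => by positivity
    · exact ((meas S hS).div_const _).aemeasurable
  have sup : ∀ S : Set (ℝ × ℝ), IsOpen S → S.Nonempty → Bornology.IsBounded S →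
      ∃ c : ℝ, 0 < c ∧ IsLUB (range (f S)) c := by
    intro S hS hn hb
    obtain ⟨R, hR⟩ := fin S hb
    have hbdd : BddAbove (range (f S)) := by
      refine ⟨max R 0, ?_⟩
      rintro _ ⟨x, rfl⟩
      refine ENNReal.toReal_le_of_le_ofReal (le_max_right _ _) ((hR x).trans ?_)
      exact ENNReal.ofReal_le_ofReal (le_max_left _ _)
    refine ⟨_, ?_, isLUB_ciSup hbdd⟩
    obtain ⟨⟨x, y⟩, hxy⟩ := hn
    refine lt_of_lt_of_le ?_ (le_ciSup hbdd x)
    refine ENNReal.toReal_pos ?_ ((hR x).trans_lt ENNReal.ofReal_lt_top).ne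
    exact ((hS.preimage (by fun_prop : Continuous (Prod.mk x))).measure_pos volume ⟨y, hxy⟩).ne'
  obtain ⟨a, ha, haL⟩ := sup A hA hAn hAb
  obtain ⟨b, hb, hbL⟩ := sup B hB hBn hBb
  refine ⟨a, b, ha, hb, ?_⟩
  rw [← ENNReal.ofReal_le_ofReal_iff (by positivity), ENNReal.ofReal_add (by positivity)
    (by positivity), vol A hA.measurableSet hAb a ha, vol B hB.measurableSet hBb b hb,
    vol C hC hCb (a + b) (by positivity)]
  rw [← lintegral_add_left']
  swap
  · refine (Antitone.measurable fun s t hst => ?_).aemeasurable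
    exact measure_mono fun x hx => hst.trans_lt hx
  refine setLIntegral_mono' measurableSet_Ioi fun t ht => ?_
  have e1 : ∀ S (c : ℝ), 0 < c → {x | t < f S x / c} = {x | t * c < f S x} := by
    intro S c hc
    ext x
    simp only [mem_ofPred_eq, lt_div_iff₀ hc]
  rw [e1 A a ha, e1 B b hb, e1 C _ (by positivity)]
  rcases lt_or_ge t 1 with h1 | h1
  · refine volume_add_le_of_measurableSet
      (measurableSet_lt measurable_const (meas A hA.measurableSet))
      (measurableSet_lt measurable_const (meas B hB.measurableSet)) ?_ ?_ ?_
    · obtain ⟨_, ⟨x, rfl⟩, hx⟩ := (lt_isLUB_iff haL).1 (show t * a < a by nlinarith)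
      exact ⟨x, hx⟩
    · obtain ⟨_, ⟨x, rfl⟩, hx⟩ := (lt_isLUB_iff hbL).1 (show t * b < b by nlinarith)
      exact ⟨x, hx⟩
    · rintro _ ⟨x, hx, y, hy, rfl⟩
      have ne : ∀ S x c, 0 < c → t * c < f S x → (Prod.mk x ⁻¹' S).Nonempty := by
        intro S x c hc h
        by_contra hne
        rw [not_nonempty_iff_eq_empty] at hne
        have : f S x = 0 := by simp [f, hne]
        rw [this] at h
        have := mul_pos (show (0:ℝ) < t from ht) hc
        linarith
      have hadd : f A x + f B y ≤ f C (x + y) := by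
        have := volume_add_le_of_measurableSet (A := Prod.mk x ⁻¹' A) (B := Prod.mk y ⁻¹' B)
          (C := Prod.mk (x + y) ⁻¹' C) (measurable_prodMk_left hA.measurableSet)
          (measurable_prodMk_left hB.measurableSet) (ne A x a ha hx) (ne B y b hb hy) (by
            rintro _ ⟨z, hz, w, hw, rfl⟩
            exact hABC (x, z) hz (y, w) hw)
        rw [← ofR A hAb, ← ofR B hBb, ← ofR C hCb, ← ENNReal.ofReal_add (by positivity)
          (by positivity), ENNReal.ofReal_le_ofReal_iff (by positivity)] at this
        exact this
      have hx' : t * a < f A x := hx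
      have hy' : t * b < f B y := hy
      show t * (a + b) < f C (x + y)
      linarith
  · have emp : ∀ S c, 0 < c → IsLUB (range (f S)) c → {x | t * c < f S x} = ∅ := by
      intro S c hc hL
      ext x
      simp only [mem_ofPred_eq, mem_empty_iff_false, iff_false, not_lt]
      have := hL.1 (mem_range_self x)
      nlinarith
    rw [emp A a ha haL, emp B b hb hbL]
    simp

/-- Brunn–Minkowski inequality in the plane. -/
theorem volume_add_two_sqrt_le {A B C : Set (ℝ × ℝ)} (hA : IsOpen A) (hB : IsOpen B)
    (hC : MeasurableSet C) (hAb : Bornology.IsBounded A) (hBb : Bornology.IsBounded B)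
    (hCb : Bornology.IsBounded C)
    (hAn : A.Nonempty) (hBn : B.Nonempty) (hABC : ∀ x ∈ A, ∀ y ∈ B, x + y ∈ C) :
    volume.real A + 2 * (√(volume.real A) * √(volume.real B)) ≤ volume.real C := by
  obtain ⟨a, b, ha, hb, h⟩ := exists_slice_bound hA hB hC hAb hBb hCb hAn hBn hABC
  rw [le_div_iff₀ (by positivity)] at h
  have hA0 : 0 ≤ volume.real A := measureReal_nonneg
  have hB0 : 0 ≤ volume.real B := measureReal_nonneg
  set X := √(volume.real A) with hX
  set Y := √(volume.real B) with hY
  rw [← Real.sq_sqrt hA0, ← Real.sq_sqrt hB0, ← hX, ← hY] at h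
  rw [← Real.sq_sqrt hA0, ← hX]
  refine le_trans ?_ h
  have : (X ^ 2 / a + Y ^ 2 / b) * (a + b) - (X ^ 2 + 2 * (X * Y)) =
      (X * b - Y * a) ^ 2 / (a * b) + Y ^ 2 := by
    field_simp
    ring
  have : 0 ≤ (X * b - Y * a) ^ 2 / (a * b) + Y ^ 2 := by positivity
  linarith
/-- Brunn–Minkowski for the `ε`-neighbourhood of a bounded open planar set. -/
theorem volume_add_le_volume_thickening {S : Set R2} (hS : IsOpen S)
    (hSb : Bornology.IsBounded S) (hSn : S.Nonempty) {ε : ℝ} (hε : 0 < ε) :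
    volume.real S + 2 * (ε * √π) * √(volume.real S) ≤ volume.real (thickening ε S) := by
  let Φ : R2 ≃ᵐ ℝ × ℝ := (MeasurableEquiv.toLp 2 (Fin 2 → ℝ)).symm.trans MeasurableEquiv.finTwoArrow
  have hΦ : MeasurePreserving Φ volume volume :=
    (volume_preserving_finTwoArrow ℝ).comp
      (EuclideanSpace.volume_preserving_symm_measurableEquiv_toLp (Fin 2))
  have hΦs : MeasurePreserving Φ.symm volume volume := hΦ.symm
  have hc : Continuous Φ.symm := by
    have : (Φ.symm : ℝ × ℝ → R2) = fun z => !₂[z.1, z.2] := rfl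
    rw [this]
    fun_prop
  have hadd : ∀ z w, Φ.symm (z + w) = Φ.symm z + Φ.symm w := by
    intro z w
    ext i
    fin_cases i <;> rfl
  have hbd : ∀ T : Set R2, Bornology.IsBounded T → Bornology.IsBounded (Φ.symm ⁻¹' T) := by
    intro T hT
    obtain ⟨R, hR⟩ := hT.subset_closedBall 0
    refine (isBounded_closedBall (x := (0 : ℝ × ℝ)) (r := R)).subset fun z hz => ?_
    have h1 := hR hz
    rw [mem_closedBall, dist_zero_right] at h1 ⊢
    rw [Prod.norm_def]
    exact max_le ((PiLp.norm_apply_le (Φ.symm z) 0).trans h1)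
      ((PiLp.norm_apply_le (Φ.symm z) 1).trans h1)
  have hv : ∀ T : Set R2, MeasurableSet T → volume.real (Φ.symm ⁻¹' T) = volume.real T :=
    fun T hT => by rw [measureReal_def, hΦs.measure_preimage hT.nullMeasurableSet, measureReal_def]
  have key := volume_add_two_sqrt_le (A := Φ.symm ⁻¹' S) (B := Φ.symm ⁻¹' (ball 0 ε))
    (C := Φ.symm ⁻¹' (thickening ε S)) (hS.preimage hc) (isOpen_ball.preimage hc)
    (hc.measurable isOpen_thickening.measurableSet) (hbd _ hSb) (hbd _ isBounded_ball)
    (hbd _ hSb.thickening) (hSn.preimage Φ.symm.surjective)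
    ((nonempty_ball.2 hε).preimage Φ.symm.surjective) (by
      intro x hx y hy
      simp only [mem_preimage, hadd, mem_thickening_iff] at hx hy ⊢
      exact ⟨_, hx, by simpa using hy⟩)
  rw [hv _ hS.measurableSet, hv _ measurableSet_ball, hv _ isOpen_thickening.measurableSet] at key
  have hb : √(volume.real (ball (0 : R2) ε)) = ε * √π := by
    rw [measureReal_def, EuclideanSpace.volume_ball_fin_two, ENNReal.toReal_mul,
      ENNReal.toReal_pow, ENNReal.toReal_ofReal hε.le, ENNReal.toReal_ofReal pi_pos.le,
      Real.sqrt_mul (by positivity), Real.sqrt_sq hε.le]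
  rw [hb] at key
  linarith

/-- Integrated isoperimetric inequality: a function reaching the level `a` on a set of measure
`m` has total variation at least `2 √π a √m`. -/
theorem isoperimetric_integral_le {g : R2 → ℝ} (hg : ContDiff ℝ 1 g) (hgc : HasCompactSupport g)
    (hg0 : ∀ x, 0 ≤ g x) {a : ℝ} (ha : 0 < a) :
    2 * √π * a * √(volume.real {x | a ≤ g x}) ≤ ∫ x, ‖fderiv ℝ g x‖ := by
  set m := volume.real {x | a ≤ g x} with hm
  have hfc : Continuous (fderiv ℝ g) := hg.continuous_fderiv one_ne_zero
  have hfs : HasCompactSupport (fderiv ℝ g) := hgc.fderiv ℝ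
  rcases eq_empty_or_nonempty {x | a ≤ g x} with he | ⟨x₀, hx₀⟩
  · rw [hm, he]
    simp only [measureReal_empty, Real.sqrt_zero, mul_zero]
    exact integral_nonneg fun x => norm_nonneg _
  have hgi : Integrable g := hg.continuous.integrable_of_hasCompactSupport hgc
  have hfi : Integrable (fun x => ‖fderiv ℝ g x‖) :=
    (hfc.integrable_of_hasCompactSupport hfs).norm
  set K := cthickening 1 (tsupport g) with hK
  have hKc : IsCompact K := hgc.isCompact.cthickening
  have hKf : volume K ≠ ⊤ := hKc.measure_lt_top.ne
  have hKm : MeasurableSet K := hKc.measurableSet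
  suffices H : ∀ ω > 0, 2 * √π * a * √m ≤ (∫ x, ‖fderiv ℝ g x‖) + ω * volume.real K by
    have hlim : Tendsto (fun ω : ℝ => (∫ x, ‖fderiv ℝ g x‖) + ω * volume.real K) (𝓝[>] 0)
        (𝓝 ((∫ x, ‖fderiv ℝ g x‖) + 0 * volume.real K)) := by
      refine Tendsto.mono_left ?_ nhdsWithin_le_nhds
      exact tendsto_const_nhds.add (tendsto_id.mul_const _)
    rw [zero_mul, add_zero] at hlim
    exact ge_of_tendsto hlim (eventually_mem_nhdsWithin.mono H)
  intro ω hω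
  obtain ⟨δ, hδ, hδ'⟩ := Metric.uniformContinuous_iff.1
    (hfs.uniformContinuous_of_continuous hfc) ω hω
  set ε := min δ 1 with hε
  have hε0 : 0 < ε := lt_min hδ one_pos
  let q : R2 → ℝ := K.indicator fun x => ‖fderiv ℝ g x‖ + ω
  have hq0 : ∀ x, 0 ≤ q x := fun x => indicator_nonneg (fun x _ => by positivity) x
  have hqi : Integrable q := by
    refine IntegrableOn.integrable_indicator ?_ hKm
    exact hfi.integrableOn.add (integrableOn_const hKf)
  have hgq : Integrable (fun x => g x + ε * q x) := hgi.add (hqi.const_mul ε)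
  have hgq0 : ∀ x, 0 ≤ g x + ε * q x := fun x => add_nonneg (hg0 x) (mul_nonneg hε0.le (hq0 x))
  have hqint : ∫ x, q x ≤ (∫ x, ‖fderiv ℝ g x‖) + ω * volume.real K := by
    rw [integral_indicator hKm, integral_add hfi.integrableOn (integrableOn_const hKf)]
    refine add_le_add (setIntegral_le_integral hfi (Eventually.of_forall fun x => norm_nonneg _)) ?_
    simp [mul_comm]
  have hsub : ∀ τ : ℝ, 0 < τ → thickening ε {x | τ < g x} ⊆ {x | τ < g x + ε * q x} := by
    intro τ hτ x hx
    obtain ⟨y, hy, hxy⟩ := mem_thickening_iff.1 hx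
    have hyg : τ < g y := hy
    have hxK : x ∈ K := by
      have hyt : y ∈ tsupport g := subset_tsupport g (by
        rw [Function.mem_support]; linarith)
      exact thickening_subset_cthickening _ _
        (mem_thickening_iff.2 ⟨y, hyt, hxy.trans_le (min_le_right _ _)⟩)
    have hder : ∀ z ∈ ball x ε, ‖fderiv ℝ g z‖ ≤ ‖fderiv ℝ g x‖ + ω := by
      intro z hz
      have h1 := hδ' (show dist z x < δ from (mem_ball.1 hz).trans_le (min_le_left _ _))
      rw [dist_eq_norm] at h1
      have := norm_sub_norm_le (fderiv ℝ g z) (fderiv ℝ g x)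
      linarith
    have h2 := (convex_ball x ε).norm_image_sub_le_of_norm_fderiv_le (𝕜 := ℝ)
      (fun z _ => hg.differentiable one_ne_zero z) hder (mem_ball_self hε0)
      (mem_ball.2 (by rwa [dist_comm]) : y ∈ ball x ε)
    have h3 : ‖y - x‖ < ε := by rwa [← dist_eq_norm, dist_comm]
    have h4 : q x = ‖fderiv ℝ g x‖ + ω := indicator_of_mem hxK _
    show τ < g x + ε * q x
    rw [h4]
    have h5 := (le_abs_self _).trans h2
    have h6 : (‖fderiv ℝ g x‖ + ω) * ‖y - x‖ ≤ (‖fderiv ℝ g x‖ + ω) * ε := by gcongr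
    linarith
  have hlev : ∀ τ : ℝ, 0 < τ → Bornology.IsBounded {x | τ < g x} := fun τ hτ =>
    hgc.isCompact.isBounded.subset fun x hx => subset_tsupport g (by
      have : τ < g x := hx
      rw [Function.mem_support]; linarith)
  have hmono : ∀ τ : ℝ, 0 < τ → volume {x | τ < g x} + (Iio a).indicator
      (fun _ => ENNReal.ofReal (2 * (ε * √π) * √m)) τ ≤ volume {x | τ < g x + ε * q x} := by
    intro τ hτ
    rcases lt_or_ge τ a with h | h
    · rw [indicator_of_mem (show τ ∈ Iio a from h)]
      refine le_trans ?_ (measure_mono (hsub τ hτ))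
      have hb := hlev τ hτ
      have h1 := volume_add_le_volume_thickening (isOpen_lt continuous_const hg.continuous)
        hb ⟨x₀, lt_of_lt_of_le h hx₀⟩ hε0
      have h2 : m ≤ volume.real {x | τ < g x} :=
        measureReal_mono (fun x hx => lt_of_lt_of_le h hx) hb.measure_lt_top.ne
      rw [← ofReal_measureReal hb.measure_lt_top.ne,
        ← ofReal_measureReal hb.thickening.measure_lt_top.ne,
        ← ENNReal.ofReal_add (by positivity) (by positivity)]
      refine ENNReal.ofReal_le_ofReal (le_trans ?_ h1)
      gcongr
    · rw [indicator_of_notMem (show τ ∉ Iio a from not_lt.2 h), add_zero]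
      exact measure_mono fun x hx => lt_of_lt_of_le (show τ < g x from hx)
        (le_add_of_nonneg_right (mul_nonneg hε0.le (hq0 x)))
  have hint := setLIntegral_mono' (μ := volume) (measurableSet_Ioi (a := (0:ℝ)))
    (fun τ hτ => hmono τ hτ)
  rw [lintegral_add_right _ (measurable_const.indicator measurableSet_Iio),
    ← lintegral_eq_lintegral_meas_lt volume (Eventually.of_forall hg0) hgi.aemeasurable,
    ← lintegral_eq_lintegral_meas_lt volume (Eventually.of_forall hgq0) hgq.aemeasurable,
    ← ofReal_integral_eq_lintegral_ofReal hgi (Eventually.of_forall hg0),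
    ← ofReal_integral_eq_lintegral_ofReal hgq (Eventually.of_forall hgq0),
    lintegral_indicator measurableSet_Iio, Measure.restrict_restrict measurableSet_Iio,
    Iio_inter_Ioi, setLIntegral_const, Real.volume_Ioo, sub_zero,
    ← ENNReal.ofReal_mul (by positivity),
    ← ENNReal.ofReal_add (integral_nonneg hg0) (by positivity),
    ENNReal.ofReal_le_ofReal_iff (integral_nonneg hgq0),
    integral_add hgi (hqi.const_mul ε), integral_const_mul] at hint
  have hfin : ε * (2 * √π * a * √m) ≤ ε * ∫ x, q x := by linarith
  exact (le_of_mul_le_mul_left hfin hε0).trans hqint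
/-- A `C¹` approximation of `x ↦ min (x, t) - s` on `[s, ∞)`, with derivative between `0` and `1`
supported in `[s, t]`. -/
theorem exists_smooth_truncation {s t δ : ℝ} (hst : s < t) (hδ : 0 < δ) :
    ∃ φ ψ : ℝ → ℝ, Continuous ψ ∧ (∀ x, HasDerivAt φ (ψ x) x) ∧ (∀ x, 0 ≤ ψ x) ∧
      (∀ x, ψ x ≤ 1) ∧ (∀ x, x ≤ s → ψ x = 0) ∧ (∀ x, t ≤ x → ψ x = 0) ∧
      (∀ x, x ≤ s → φ x = 0) ∧ (∀ x, t ≤ x → φ x = φ t) ∧ Monotone φ ∧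
      (∀ x, s ≤ x → x ≤ t → x - s - δ ≤ φ x) ∧ φ t ≤ t - s := by
  set η := δ / 2 with hη
  have hη0 : 0 < η := by positivity
  let ψ : ℝ → ℝ := fun x => max 0 (min 1 (min ((x - s) / η) ((t - x) / η)))
  have hψc : Continuous ψ := by fun_prop
  have h0 : ∀ x, 0 ≤ ψ x := fun x => le_max_left _ _
  have h1 : ∀ x, ψ x ≤ 1 := fun x => max_le zero_le_one (min_le_left _ _)
  have hs : ∀ x, x ≤ s → ψ x = 0 := fun x hx => max_eq_left
    ((min_le_right _ _).trans ((min_le_left _ _).trans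
      (div_nonpos_of_nonpos_of_nonneg (by linarith) hη0.le)))
  have ht : ∀ x, t ≤ x → ψ x = 0 := fun x hx => max_eq_left
    ((min_le_right _ _).trans ((min_le_right _ _).trans
      (div_nonpos_of_nonpos_of_nonneg (by linarith) hη0.le)))
  have hi : ∀ a b, IntervalIntegrable ψ volume a b := fun a b => hψc.intervalIntegrable a b
  have hder : ∀ x, HasDerivAt (fun x => ∫ y in s..x, ψ y) (ψ x) x := fun x =>
    intervalIntegral.integral_hasDerivAt_right (hi _ _)
      hψc.stronglyMeasurable.stronglyMeasurableAtFilter hψc.continuousAt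
  have hmono : Monotone (fun x => ∫ y in s..x, ψ y) :=
    monotone_of_hasDerivAt_nonneg hder h0
  refine ⟨fun x => ∫ y in s..x, ψ y, ψ, hψc, hder, h0, h1, hs, ht, ?_, ?_, hmono, ?_, ?_⟩
  · intro x hx
    show ∫ y in s..x, ψ y = 0
    rw [intervalIntegral.integral_symm, intervalIntegral.integral_zero_ae, neg_zero]
    refine Eventually.of_forall fun y hy => hs y ?_
    rw [uIoc_of_le hx] at hy
    exact hy.2
  · intro x hx
    show ∫ y in s..x, ψ y = ∫ y in s..t, ψ y
    rw [← intervalIntegral.integral_add_adjacent_intervals (hi s t) (hi t x),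
      intervalIntegral.integral_zero_ae (a := t), add_zero]
    refine Eventually.of_forall fun y hy => ht y ?_
    rw [uIoc_of_le hx] at hy
    exact hy.1.le
  · intro x hsx hxt
    show x - s - δ ≤ ∫ y in s..x, ψ y
    rcases le_or_gt (x - η) (s + η) with h | h
    · refine le_trans ?_ (intervalIntegral.integral_nonneg hsx fun y _ => h0 y)
      linarith
    · have hone : ∀ y ∈ Icc (s + η) (x - η), (1 : ℝ) ≤ ψ y := by
        intro y hy
        refine le_max_of_le_right (le_min le_rfl (le_min ?_ ?_)) <;>
        · rw [le_div_iff₀ hη0]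
          linarith [hy.1, hy.2]
      have h2 : ∫ y in (s + η)..(x - η), (1 : ℝ) ≤ ∫ y in (s + η)..(x - η), ψ y :=
        intervalIntegral.integral_mono_on h.le (by simp) (hi _ _) hone
      rw [intervalIntegral.integral_const, smul_eq_mul, mul_one] at h2
      have h3 := intervalIntegral.integral_add_adjacent_intervals (hi s (s + η))
        (hi (s + η) (x - η))
      have h4 := intervalIntegral.integral_add_adjacent_intervals (hi s (x - η)) (hi (x - η) x)
      have h5 : 0 ≤ ∫ y in s..(s + η), ψ y :=
        intervalIntegral.integral_nonneg (by linarith) fun y _ => h0 y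
      have h6 : 0 ≤ ∫ y in (x - η)..x, ψ y :=
        intervalIntegral.integral_nonneg (by linarith) fun y _ => h0 y
      linarith
  · have : ∫ y in s..t, ψ y ≤ ∫ y in s..t, (1 : ℝ) :=
      intervalIntegral.integral_mono_on hst.le (hi _ _) (by simp) fun y _ => h1 y
    simpa using this

/-- The squared operator norm of a linear form on the plane. -/
theorem norm_sq_eq_sum_apply_single (L : R2 →L[ℝ] ℝ) :
    ‖L‖ ^ 2 = ∑ i : Fin 2, L (EuclideanSpace.single i 1) ^ 2 := by
  have h := (InnerProductSpace.toDual ℝ R2).symm.norm_map L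
  rw [← h, EuclideanSpace.norm_sq_eq]
  refine Finset.sum_congr rfl fun i _ => ?_
  rw [← InnerProductSpace.toDual_symm_apply (𝕜 := ℝ) (E := R2), EuclideanSpace.inner_single_right]
  simp

/-- A function continuous on an open set and vanishing off a compact subset is integrable. -/
theorem integrable_of_continuousOn_of_compact {Ω K : Set R2} (hK : IsCompact K) (hKΩ : K ⊆ Ω)
    {f : R2 → ℝ} (hf : ContinuousOn f Ω) (h0 : ∀ x ∉ K, f x = 0) : Integrable f := by
  rw [← integrableOn_iff_integrable_of_support_subset (s := K)]
  · exact (hf.mono hKΩ).integrableOn_compact hK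
  · intro x hx
    by_contra h
    exact hx (h0 x h)

section Truncation

variable {Ω : Set R2} {u : R2 → ℝ} {φ ψ : ℝ → ℝ} {s : ℝ}

/-- Superlevel sets of a function vanishing on the boundary are compact. -/
theorem isCompact_superlevel (hb : Bornology.IsBounded Ω) (hop : IsOpen Ω)
    (hu : ContinuousOn u (closure Ω)) (h0 : ∀ x ∈ frontier Ω, u x = 0) (hs : 0 < s) :
    IsCompact {x ∈ Ω | s ≤ u x} := by
  have : {x ∈ Ω | s ≤ u x} = closure Ω ∩ u ⁻¹' Ici s := by
    ext x
    constructor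
    · rintro ⟨h1, h2⟩
      exact ⟨subset_closure h1, h2⟩
    · rintro ⟨h1, h2⟩
      refine ⟨?_, h2⟩
      by_contra hx
      have h3 := h0 x (by rw [hop.frontier_eq]; exact ⟨h1, hx⟩)
      rw [mem_preimage, h3, mem_Ici] at h2
      linarith
  rw [this]
  exact hb.isCompact_closure.of_isClosed_subset
    (hu.preimage_isClosed_of_isClosed isClosed_closure isClosed_Ici) inter_subset_left

/-- Extension by zero of a truncation `φ ∘ u`: value of the derivative. -/
theorem hasFDerivAt_truncation (hop : IsOpen Ω) (hu2 : ContDiffOn ℝ 2 u Ω)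
    (hK : IsCompact {x ∈ Ω | s ≤ u x})
    (hd : ∀ x, HasDerivAt φ (ψ x) x) (hφ : ∀ x, x ≤ s → φ x = 0) (x : R2) :
    HasFDerivAt (Ω.indicator (φ ∘ u)) (Ω.indicator (fun y => ψ (u y) • fderiv ℝ u y) x) x := by
  by_cases hx : x ∈ Ω
  · rw [indicator_of_mem hx]
    have h1 : HasFDerivAt u (fderiv ℝ u x) x :=
      ((hu2.contDiffAt (hop.mem_nhds hx)).differentiableAt two_ne_zero).hasFDerivAt
    refine ((hd (u x)).comp_hasFDerivAt x h1).congr_of_eventuallyEq ?_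
    filter_upwards [hop.mem_nhds hx] with y hy
    exact indicator_of_mem hy _
  · rw [indicator_of_notMem hx]
    refine (hasFDerivAt_const (0 : ℝ) x).congr_of_eventuallyEq ?_
    filter_upwards [hK.isClosed.isOpen_compl.mem_nhds
      (show x ∉ {x ∈ Ω | s ≤ u x} from fun h => hx h.1)] with y hy
    by_cases hyΩ : y ∈ Ω
    · rw [indicator_of_mem hyΩ]
      refine hφ _ ?_
      by_contra hlt
      exact hy ⟨hyΩ, (not_le.1 hlt).le⟩
    · exact indicator_of_notMem hyΩ _

theorem contDiff_truncation (hop : IsOpen Ω) (hu2 : ContDiffOn ℝ 2 u Ω)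
    (hK : IsCompact {x ∈ Ω | s ≤ u x}) (hψc : Continuous ψ)
    (hd : ∀ x, HasDerivAt φ (ψ x) x) (hφ : ∀ x, x ≤ s → φ x = 0) (hψ : ∀ x, x ≤ s → ψ x = 0) :
    ContDiff ℝ 1 (Ω.indicator (φ ∘ u)) := by
  have hD := hasFDerivAt_truncation hop hu2 hK hd hφ
  rw [contDiff_one_iff_fderiv]
  refine ⟨fun x => (hD x).differentiableAt, ?_⟩
  have he : fderiv ℝ (Ω.indicator (φ ∘ u)) = Ω.indicator (fun y => ψ (u y) • fderiv ℝ u y) :=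
    funext fun x => (hD x).fderiv
  rw [he, continuous_iff_continuousAt]
  intro x
  by_cases hx : x ∈ Ω
  · have h1 : ContinuousOn (fun y => ψ (u y) • fderiv ℝ u y) Ω :=
      (hψc.comp_continuousOn hu2.continuousOn).smul
        (hu2.continuousOn_fderiv_of_isOpen hop one_le_two)
    refine (h1.continuousAt (hop.mem_nhds hx)).congr ?_
    filter_upwards [hop.mem_nhds hx] with y hy
    rw [indicator_of_mem hy]
  · refine (continuousAt_const (y := (0 : R2 →L[ℝ] ℝ))).congr ?_
    filter_upwards [hK.isClosed.isOpen_compl.mem_nhds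
      (show x ∉ {x ∈ Ω | s ≤ u x} from fun h => hx h.1)] with y hy
    by_cases hyΩ : y ∈ Ω
    · rw [indicator_of_mem hyΩ, hψ _, zero_smul]
      by_contra hlt
      exact hy ⟨hyΩ, (not_le.1 hlt).le⟩
    · rw [indicator_of_notMem hyΩ]

theorem tsupport_truncation (hK : IsCompact {x ∈ Ω | s ≤ u x}) (hφ : ∀ x, x ≤ s → φ x = 0) :
    tsupport (Ω.indicator (φ ∘ u)) ⊆ {x ∈ Ω | s ≤ u x} := by
  refine closure_minimal (fun x hx => ?_) hK.isClosed
  rw [Function.mem_support] at hx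
  have hxΩ : x ∈ Ω := by
    by_contra h
    exact hx (indicator_of_notMem h _)
  refine ⟨hxΩ, ?_⟩
  by_contra h
  rw [indicator_of_mem hxΩ] at hx
  exact hx (hφ _ (not_le.1 h).le)

/-- Green's identity tested against a truncation of `u`. -/
theorem integral_truncation_eq (hop : IsOpen Ω) (hu2 : ContDiffOn ℝ 2 u Ω)
    (hK : IsCompact {x ∈ Ω | s ≤ u x}) (hψc : Continuous ψ)
    (hd : ∀ x, HasDerivAt φ (ψ x) x) (hφ : ∀ x, x ≤ s → φ x = 0) (hψ : ∀ x, x ≤ s → ψ x = 0) :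
    ∫ x in Ω, ψ (u x) * ‖fderiv ℝ u x‖ ^ 2 = ∫ x in Ω, φ (u x) * -lap u x := by
  set g := Ω.indicator (φ ∘ u) with hg
  have hgC := contDiff_truncation hop hu2 hK hψc hd hφ hψ
  have hgt := tsupport_truncation hK hφ
  have hD := hasFDerivAt_truncation hop hu2 hK hd hφ
  have hDu : ContDiffOn ℝ 1 (fderiv ℝ u) Ω := hu2.fderiv_of_isOpen hop (by norm_num)
  let U : Fin 2 → R2 → ℝ := fun i y => fderiv ℝ u y (EuclideanSpace.single i 1)
  have hU : ∀ i, ContDiffOn ℝ 1 (U i) Ω := fun i => hDu.clm_apply contDiffOn_const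
  have hU' : ∀ i, ContinuousOn (fun y => fderiv ℝ (U i) y (EuclideanSpace.single i 1)) Ω :=
    fun i => ((hU i).continuousOn_fderiv_of_isOpen hop le_rfl).clm_apply continuousOn_const
  have hg0 : ∀ x ∉ {x ∈ Ω | s ≤ u x}, g x = 0 := fun x hx =>
    image_eq_zero_of_notMem_tsupport fun h => hx (hgt h)
  have hg0' : ∀ x ∉ {x ∈ Ω | s ≤ u x}, fderiv ℝ g x = 0 := fun x hx => by
    by_contra h
    exact hx (hgt (support_fderiv_subset ℝ h))
  have hKΩ : {x ∈ Ω | s ≤ u x} ⊆ Ω := fun x hx => hx.1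
  have hgf : Continuous (fderiv ℝ g) := hgC.continuous_fderiv one_ne_zero
  have I1 : ∀ i, Integrable (fun x => fderiv ℝ g x (EuclideanSpace.single i 1) * U i x) :=
    fun i => integrable_of_continuousOn_of_compact hK hKΩ
      ((hgf.continuousOn.clm_apply continuousOn_const).mul (hU i).continuousOn)
      fun x hx => by rw [hg0' x hx]; simp
  have I2 : ∀ i, Integrable (fun x => g x * fderiv ℝ (U i) x (EuclideanSpace.single i 1)) :=
    fun i => integrable_of_continuousOn_of_compact hK hKΩ
      (hgC.continuous.continuousOn.mul (hU' i)) fun x hx => by rw [hg0 x hx, zero_mul]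
  have I3 : ∀ i, Integrable (fun x => g x * U i x) :=
    fun i => integrable_of_continuousOn_of_compact hK hKΩ
      (hgC.continuous.continuousOn.mul (hU i).continuousOn) fun x hx => by rw [hg0 x hx, zero_mul]
  have key : ∀ i, ∫ x, g x * fderiv ℝ (U i) x (EuclideanSpace.single i 1) =
      -∫ x, fderiv ℝ g x (EuclideanSpace.single i 1) * U i x := fun i =>
    integral_mul_fderiv_eq_neg_fderiv_mul_of_integrable (I1 i) (I2 i) (I3 i)
      (fun x _ => hgC.differentiable one_ne_zero x)
      (fun x hx => ((hU i).contDiffAt (hop.mem_nhds (hKΩ (hgt hx)))).differentiableAt one_ne_zero)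
  have hsum : ∫ x, ∑ i, g x * fderiv ℝ (U i) x (EuclideanSpace.single i 1) =
      -∫ x, ∑ i, fderiv ℝ g x (EuclideanSpace.single i 1) * U i x := by
    rw [integral_finsetSum _ fun i _ => I2 i, integral_finsetSum _ fun i _ => I1 i,
      ← Finset.sum_neg_distrib]
    exact Finset.sum_congr rfl fun i _ => key i
  have e1 : ∫ x in Ω, φ (u x) * -lap u x =
      -∫ x, ∑ i, g x * fderiv ℝ (U i) x (EuclideanSpace.single i 1) := by
    rw [← integral_indicator hop.measurableSet, ← integral_neg]
    congr 1
    ext x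
    by_cases hx : x ∈ Ω
    · rw [indicator_of_mem hx, hg, indicator_of_mem hx, ← Finset.mul_sum]
      simp only [lap, Function.comp_apply, mul_neg, U]
    · rw [indicator_of_notMem hx, hg, indicator_of_notMem hx]
      simp
  have e2 : ∫ x in Ω, ψ (u x) * ‖fderiv ℝ u x‖ ^ 2 =
      ∫ x, ∑ i, fderiv ℝ g x (EuclideanSpace.single i 1) * U i x := by
    rw [← integral_indicator hop.measurableSet]
    congr 1
    ext x
    rw [(hD x).fderiv]
    by_cases hx : x ∈ Ω
    · rw [indicator_of_mem hx, indicator_of_mem hx, norm_sq_eq_sum_apply_single, Finset.mul_sum]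
      refine Finset.sum_congr rfl fun i _ => ?_
      simp only [_root_.smul_apply, smul_eq_mul, U]
      ring
    · rw [indicator_of_notMem hx, indicator_of_notMem hx]
      simp
  rw [e1, e2, hsum, neg_neg]

end Truncation
section Solution

variable {Ω : Set R2} {u : R2 → ℝ} {p : ℝ}

theorem continuousOn_nonlinearity (hp : 1 < p) (huc : ContinuousOn u (closure Ω)) :
    ContinuousOn (fun x => |u x| ^ (p - 1) * u x) (closure Ω) :=
  (huc.abs.rpow_const fun _ _ => Or.inr (by linarith)).mul huc

theorem integrableOn_of_continuousOn_closure (hb : Bornology.IsBounded Ω) {f : R2 → ℝ}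
    (hf : ContinuousOn f (closure Ω)) : IntegrableOn f Ω :=
  (hf.integrableOn_compact hb.isCompact_closure).mono_set subset_closure

/-- Level-set inequality for solutions, obtained from the isoperimetric inequality, the
Cauchy–Schwarz inequality and the equation. -/
theorem level_inequality (hp : 1 < p) (hb : Bornology.IsBounded Ω) (hop : IsOpen Ω)
    (hu2 : ContDiffOn ℝ 2 u Ω) (huc : ContinuousOn u (closure Ω))
    (heq : ∀ x ∈ Ω, -lap u x = |u x| ^ (p - 1) * u x) (h0 : ∀ x ∈ frontier Ω, u x = 0)
    {s t : ℝ} (hs : 0 < s) (hst : s < t) :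
    4 * π * (t - s) * volume.real {x ∈ Ω | t < u x} ≤
      (∫ x in {x ∈ Ω | s < u x}, |u x| ^ (p - 1) * u x) *
        (volume.real {x ∈ Ω | s < u x} - volume.real {x ∈ Ω | t < u x}) := by
  set m := volume.real {x ∈ Ω | t < u x} with hm
  set N := volume.real {x ∈ Ω | s < u x} - m with hN
  set F := ∫ x in {x ∈ Ω | s < u x}, |u x| ^ (p - 1) * u x with hF
  have huΩ : ContinuousOn u Ω := huc.mono subset_closure
  have hopen : ∀ r, IsOpen {x ∈ Ω | r < u x} := fun r =>
    huΩ.isOpen_inter_preimage hop isOpen_Ioi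
  have hK := isCompact_superlevel hb hop huc h0 hs
  have hfin : ∀ r, volume {x ∈ Ω | r < u x} ≠ ⊤ := fun r =>
    (hb.subset fun x hx => hx.1).measure_lt_top.ne
  have hsub : {x ∈ Ω | t < u x} ⊆ {x ∈ Ω | s < u x} := fun x hx => ⟨hx.1, hst.trans hx.2⟩
  have hm0 : 0 ≤ m := measureReal_nonneg
  have hN0 : 0 ≤ N := sub_nonneg.2 (measureReal_mono hsub (hfin s))
  have hNI := integrableOn_of_continuousOn_closure hb (continuousOn_nonlinearity hp huc)
  have hF0 : 0 ≤ F := setIntegral_nonneg (hopen s).measurableSet fun x hx =>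
    mul_nonneg (by positivity) (hs.trans hx.2).le
  suffices H : ∀ δ > 0, δ < t - s → 4 * π * (t - s - δ) * m ≤ F * N by
    have hlim : Tendsto (fun δ : ℝ => 4 * π * (t - s - δ) * m) (𝓝[>] 0)
        (𝓝 (4 * π * (t - s - 0) * m)) :=
      (Continuous.tendsto (by fun_prop) 0).mono_left nhdsWithin_le_nhds
    rw [sub_zero] at hlim
    refine le_of_tendsto hlim ?_
    filter_upwards [Ioo_mem_nhdsGT (sub_pos.2 hst)] with δ hδ using H δ hδ.1 hδ.2
  intro δ hδ hδ'
  obtain ⟨φ, ψ, hψc, hd, hψ0, hψ1, hψs, hψt, hφs, hφt, hφm, hφl, -⟩ :=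
    exists_smooth_truncation hst hδ
  set A := φ t with hA
  have hAδ : t - s - δ ≤ A := hφl t hst.le le_rfl
  have hA0 : 0 < A := by linarith
  have hφ0 : ∀ x, 0 ≤ φ x := fun x => by
    rcases le_total x s with h | h
    · exact (hφs x h).ge
    · exact (hφs s le_rfl).ge.trans (hφm h)
  have hφA : ∀ x, φ x ≤ A := fun x => by
    rcases le_total x t with h | h
    · exact hφm h
    · exact (hφt x h).le
  -- the isoperimetric inequality for the truncation
  set g := Ω.indicator (φ ∘ u) with hg
  have hgC : ContDiff ℝ 1 g := contDiff_truncation hop hu2 hK hψc hd hφs hψs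
  have hgt : tsupport g ⊆ {x ∈ Ω | s ≤ u x} := tsupport_truncation hK hφs
  have hD : ∀ x, HasFDerivAt g (Ω.indicator (fun y => ψ (u y) • fderiv ℝ u y) x) x :=
    hasFDerivAt_truncation hop hu2 hK hd hφs
  have hgc : HasCompactSupport g := hK.of_isClosed_subset (isClosed_tsupport g) hgt
  have hiso := isoperimetric_integral_le hgC hgc
    (fun x => indicator_nonneg (fun y _ => hφ0 (u y)) x) hA0
  have hmle : m ≤ volume.real {x | A ≤ g x} := by
    refine measureReal_mono (fun x hx => ?_) ?_
    · show A ≤ g x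
      rw [hg, indicator_of_mem hx.1]
      exact (hφt _ hx.2.le).ge
    · refine (hK.isBounded.subset fun x hx => hgt (subset_tsupport g ?_)).measure_lt_top.ne
      rw [Function.mem_support]
      exact (hA0.trans_le hx).ne'
  have hgrad : ∀ x, ‖fderiv ℝ g x‖ = Ω.indicator (fun y => ψ (u y) * ‖fderiv ℝ u y‖) x := by
    intro x
    rw [(hD x).fderiv]
    by_cases hx : x ∈ Ω
    · rw [indicator_of_mem hx, indicator_of_mem hx, norm_smul, Real.norm_of_nonneg (hψ0 _)]
    · rw [indicator_of_notMem hx, indicator_of_notMem hx, norm_zero]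
  simp_rw [hgrad] at hiso
  rw [integral_indicator hop.measurableSet] at hiso
  set Y := ∫ x in Ω, ψ (u x) * ‖fderiv ℝ u x‖ with hY
  have hiso' : 2 * √π * A * √m ≤ Y := le_trans (by gcongr) hiso
  -- the equation tested against the truncation
  set X := ∫ x in Ω, ψ (u x) * ‖fderiv ℝ u x‖ ^ 2 with hX
  have hXF : X ≤ A * F := by
    rw [hX, integral_truncation_eq hop hu2 hK hψc hd hφs hψs, hF, ← integral_const_mul,
      ← integral_indicator (hopen s).measurableSet, ← integral_indicator hop.measurableSet]
    have hφc : Continuous φ := continuous_iff_continuousAt.2 fun x => (hd x).continuousAt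
    refine integral_mono ?_ ?_ fun x => ?_
    · refine IntegrableOn.integrable_indicator ?_ hop.measurableSet
      refine (integrableOn_of_continuousOn_closure hb ((hφc.comp_continuousOn huc).mul
        (continuousOn_nonlinearity hp huc))).congr_fun (fun x hx => ?_) hop.measurableSet
      rw [heq x hx]
      rfl
    · refine IntegrableOn.integrable_indicator ?_ (hopen s).measurableSet
      exact (hNI.mono_set fun x hx => hx.1).const_mul A
    · by_cases hx : x ∈ Ω
      · rw [indicator_of_mem hx]
        by_cases hxs : s < u x
        · rw [indicator_of_mem (show x ∈ {x ∈ Ω | s < u x} from ⟨hx, hxs⟩), heq x hx]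
          have : 0 ≤ |u x| ^ (p - 1) * u x := mul_nonneg (by positivity) (hs.trans hxs).le
          have := hφA (u x)
          gcongr
        · rw [hφs _ (not_lt.1 hxs), zero_mul]
          exact indicator_nonneg (fun y hy => mul_nonneg hA0.le
            (mul_nonneg (by positivity) (hs.trans hy.2).le)) x
      · rw [indicator_of_notMem hx]
        exact indicator_nonneg (fun y hy => mul_nonneg hA0.le
          (mul_nonneg (by positivity) (hs.trans hy.2).le)) x
  have hX0 : 0 ≤ X := integral_nonneg fun x => mul_nonneg (hψ0 _) (by positivity)
  have hY0 : 0 ≤ Y := integral_nonneg fun x => mul_nonneg (hψ0 _) (by positivity)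
  have hKΩ : {x ∈ Ω | s ≤ u x} ⊆ Ω := fun x hx => hx.1
  have hint : ∀ f : R2 → ℝ, ContinuousOn f Ω → IntegrableOn (fun x => ψ (u x) * f x) Ω := by
    intro f hf
    rw [← integrable_indicator_iff hop.measurableSet]
    refine integrable_of_continuousOn_of_compact hK hKΩ ?_ ?_
    · refine ((hψc.comp_continuousOn huΩ).mul hf).congr fun x hx => ?_
      exact indicator_of_mem hx _
    · intro x hx
      refine indicator_apply_eq_zero.2 fun hxΩ => ?_
      rw [hψs, zero_mul]
      by_contra h
      exact hx ⟨hxΩ, (not_le.1 h).le⟩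
  have hDuc : ContinuousOn (fun x => ‖fderiv ℝ u x‖) Ω :=
    (hu2.continuousOn_fderiv_of_isOpen hop one_le_two).norm
  have hDuc2 : ContinuousOn (fun x => ‖fderiv ℝ u x‖ ^ 2) Ω := hDuc.pow 2
  have hcs : ∀ r > 0, 2 * Y ≤ r * X + r⁻¹ * N := by
    intro r hr
    have hψN : ∫ x in Ω, ψ (u x) * 1 ≤ N := by
      have hdiff : N = ∫ x in Ω, ({x ∈ Ω | s < u x} \ {x ∈ Ω | t < u x}).indicator
          (fun _ => (1 : ℝ)) x := by
        rw [setIntegral_indicator ((hopen s).measurableSet.diff (hopen t).measurableSet),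
          setIntegral_const, smul_eq_mul, mul_one, hN, hm,
          inter_eq_right.2 (fun x hx => hx.1.1),
          measureReal_sdiff hsub (hopen t).measurableSet (hfin s)]
      rw [hdiff]
      refine setIntegral_mono_on (hint _ continuousOn_const) ?_ hop.measurableSet fun x hx => ?_
      · refine Integrable.indicator ?_ ((hopen s).measurableSet.diff (hopen t).measurableSet)
        exact integrableOn_const hb.measure_lt_top.ne
      · by_cases h : x ∈ {x ∈ Ω | s < u x} \ {x ∈ Ω | t < u x}
        · rw [indicator_of_mem h, mul_one]
          exact hψ1 _
        · rw [indicator_of_notMem h, mul_one]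
          rcases le_or_gt (u x) s with h1 | h1
          · exact (hψs _ h1).le
          · refine (hψt _ ?_).le
            by_contra h2
            exact h ⟨⟨hx, h1⟩, fun h3 => h2 h3.2.le⟩
    calc 2 * Y = ∫ x in Ω, 2 * (ψ (u x) * ‖fderiv ℝ u x‖) := (integral_const_mul _ _).symm
      _ ≤ ∫ x in Ω, (r * (ψ (u x) * ‖fderiv ℝ u x‖ ^ 2) + r⁻¹ * (ψ (u x) * 1)) := by
        refine setIntegral_mono_on ((hint _ hDuc).const_mul 2)
          (((hint _ hDuc2).const_mul r).add ((hint (fun _ => 1) continuousOn_const).const_mul r⁻¹))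
          hop.measurableSet fun x _ => ?_
        have h1 : 0 ≤ ψ (u x) * (r⁻¹ * (r * ‖fderiv ℝ u x‖ - 1) ^ 2) :=
          mul_nonneg (hψ0 _) (by positivity)
        have h2 : r⁻¹ * (r * ‖fderiv ℝ u x‖ - 1) ^ 2 =
            r * ‖fderiv ℝ u x‖ ^ 2 - 2 * ‖fderiv ℝ u x‖ + r⁻¹ := by
          field_simp
          ring
        rw [h2] at h1
        linarith
      _ = r * X + r⁻¹ * ∫ x in Ω, ψ (u x) * 1 := by
        rw [integral_add ((hint _ hDuc2).const_mul r)
          ((hint (fun _ => 1) continuousOn_const).const_mul r⁻¹), integral_const_mul,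
          integral_const_mul]
      _ ≤ r * X + r⁻¹ * N := by gcongr
  have hdisc : Y ^ 2 ≤ X * N := by
    have h1 : ∀ r : ℝ, 0 ≤ X * (r * r) + (-(2 * Y)) * r + N := by
      intro r
      rcases le_or_gt r 0 with hr | hr
      · nlinarith [mul_nonneg hX0 (mul_self_nonneg r), mul_nonneg hY0 (neg_nonneg.2 hr)]
      · have h2 := mul_le_mul_of_nonneg_right (hcs r hr) hr.le
        have h3 : (r * X + r⁻¹ * N) * r = X * (r * r) + N := by
          field_simp
        linarith
    have h2 := discrim_le_zero h1
    rw [discrim] at h2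
    linarith
  have hsq : (2 * √π * A * √m) ^ 2 ≤ Y ^ 2 := pow_le_pow_left₀ (by positivity) hiso' 2
  have hexp : (2 * √π * A * √m) ^ 2 = A * (4 * π * A * m) := by
    rw [mul_pow, mul_pow, mul_pow, Real.sq_sqrt pi_pos.le, Real.sq_sqrt hm0]
    ring
  have hfinal : A * (4 * π * A * m) ≤ A * (F * N) := by
    rw [← hexp]
    refine hsq.trans (hdisc.trans ?_)
    rw [← mul_assoc]
    gcongr
  have h4 := le_of_mul_le_mul_left hfinal hA0
  refine le_trans ?_ h4
  gcongr

/-- The potential energy of the positive part is controlled by its Dirichlet energy. -/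
theorem integral_pos_part_le (hp : 1 < p) (hb : Bornology.IsBounded Ω) (hop : IsOpen Ω)
    (hu2 : ContDiffOn ℝ 2 u Ω) (huc : ContinuousOn u (closure Ω))
    (heq : ∀ x ∈ Ω, -lap u x = |u x| ^ (p - 1) * u x) (h0 : ∀ x ∈ frontier Ω, u x = 0)
    {M : ℝ} (hM : ∀ x ∈ Ω, u x ≤ M) (hgi : IntegrableOn (fun x => ‖fderiv ℝ u x‖ ^ 2) Ω) :
    ∫ x in {x ∈ Ω | 0 < u x}, |u x| ^ (p - 1) * u x * u x ≤
      ∫ x in {x ∈ Ω | 0 < u x}, ‖fderiv ℝ u x‖ ^ 2 := by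
  set P := {x ∈ Ω | 0 < u x} with hP
  have huΩ : ContinuousOn u Ω := huc.mono subset_closure
  have hPm : MeasurableSet P := (huΩ.isOpen_inter_preimage hop isOpen_Ioi).measurableSet
  have hPΩ : P ⊆ Ω := fun x hx => hx.1
  set f : R2 → ℝ := fun x => |u x| ^ (p - 1) * u x with hf
  have hfc : ContinuousOn f (closure Ω) := continuousOn_nonlinearity hp huc
  have hfI := (integrableOn_of_continuousOn_closure hb hfc).mono_set hPΩ
  have hfuI : IntegrableOn (fun x => f x * u x) P :=
    (integrableOn_of_continuousOn_closure hb (hfc.mul huc)).mono_set hPΩ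
  have hf0 : ∀ x ∈ P, 0 ≤ f x := fun x hx => mul_nonneg (by positivity) hx.2.le
  suffices H : ∀ δ > 0, (∫ x in P, f x * u x) - 2 * δ * (∫ x in P, f x) ≤
      ∫ x in P, ‖fderiv ℝ u x‖ ^ 2 by
    have hlim : Tendsto (fun δ : ℝ => (∫ x in P, f x * u x) - 2 * δ * (∫ x in P, f x)) (𝓝[>] 0)
        (𝓝 ((∫ x in P, f x * u x) - 2 * 0 * (∫ x in P, f x))) :=
      (Continuous.tendsto (by fun_prop) 0).mono_left nhdsWithin_le_nhds
    rw [mul_zero, zero_mul, sub_zero] at hlim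
    exact le_of_tendsto hlim (eventually_mem_nhdsWithin.mono H)
  intro δ hδ
  have hst : δ < max M δ + 1 := by
    have := le_max_right M δ
    linarith
  obtain ⟨φ, ψ, hψc, hd, hψ0, hψ1, hψs, -, hφs, -, hφm, hφl, -⟩ :=
    exists_smooth_truncation hst hδ
  have hK := isCompact_superlevel hb hop huc h0 hδ
  have hφc : Continuous φ := continuous_iff_continuousAt.2 fun x => (hd x).continuousAt
  have key := integral_truncation_eq hop hu2 hK hψc hd hφs hψs
  have hφ0 : ∀ x, 0 ≤ φ x := fun x => by
    rcases le_total x δ with h | h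
    · exact (hφs x h).ge
    · exact (hφs δ le_rfl).ge.trans (hφm h)
  have hrest : ∀ h : R2 → ℝ, (∀ x ∈ Ω, u x ≤ 0 → h x = 0) → ∫ x in Ω, h x = ∫ x in P, h x := by
    intro h hh
    have hz : ∀ x ∈ Ω \ P, h x = 0 := fun x hx =>
      hh x hx.1 (not_lt.1 fun h => hx.2 ⟨hx.1, h⟩)
    exact setIntegral_eq_of_subset_of_forall_sdiff_eq_zero hop.measurableSet hPΩ hz
  rw [hrest _ fun x _ h => by rw [hψs _ (by linarith), zero_mul],
    hrest _ fun x _ h => by rw [hφs _ (by linarith), zero_mul]] at key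
  have hφI : IntegrableOn (fun x => φ (u x) * -lap u x) P := by
    refine ((integrableOn_of_continuousOn_closure hb
      ((hφc.comp_continuousOn huc).mul hfc)).mono_set hPΩ).congr_fun (fun x hx => ?_) hPm
    rw [heq x hx.1]
    rfl
  calc (∫ x in P, f x * u x) - 2 * δ * ∫ x in P, f x
      = ∫ x in P, (f x * u x - 2 * δ * f x) := by
        rw [integral_sub hfuI (hfI.const_mul _), integral_const_mul]
    _ ≤ ∫ x in P, φ (u x) * -lap u x := by
        refine setIntegral_mono_on (hfuI.sub (hfI.const_mul _)) hφI hPm fun x hx => ?_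
        rw [heq x hx.1]
        change f x * u x - 2 * δ * f x ≤ φ (u x) * f x
        have h1 : u x - 2 * δ ≤ φ (u x) := by
          rcases le_total (u x) δ with h | h
          · have := hφ0 (u x)
            linarith
          · have := hφl (u x) h (by
              have := hM x hx.1
              have := le_max_left M δ
              linarith)
            linarith
        have := mul_le_mul_of_nonneg_right h1 (hf0 x hx)
        linarith
    _ = ∫ x in P, ψ (u x) * ‖fderiv ℝ u x‖ ^ 2 := key.symm
    _ ≤ ∫ x in P, ‖fderiv ℝ u x‖ ^ 2 := by
        refine integral_mono_of_nonneg (Eventually.of_forall fun x =>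
          mul_nonneg (hψ0 _) (by positivity)) (hgi.mono_set hPΩ) (Eventually.of_forall fun x => ?_)
        exact mul_le_of_le_one_left (by positivity) (hψ1 _)

end Solution
section LevelFunctions

/-- A monotone function increases at least by the integral of any lower bound for its
derivative. -/
theorem integral_le_sub_of_monotoneOn {f r : ℝ → ℝ} {a b : ℝ} (hab : a ≤ b)
    (hf : MonotoneOn f (Icc a b)) (hr : IntervalIntegrable r volume a b)
    (h : ∀ᵐ t, t ∈ Ioo a b → ∃ d, HasDerivAt f d t ∧ r t ≤ d) :
    ∫ t in a..b, r t ≤ f b - f a := by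
  rw [← uIcc_of_le hab] at hf
  have h1 := hf.intervalIntegral_deriv_mem_uIcc
  have hfab : f a ≤ f b := hf left_mem_uIcc right_mem_uIcc hab
  rw [uIcc_of_le (sub_nonneg.2 hfab)] at h1
  refine le_trans ?_ h1.2
  refine intervalIntegral.integral_mono_ae_restrict hab hr hf.intervalIntegrable_deriv ?_
  rw [← restrict_Ioo_eq_restrict_Icc]
  filter_upwards [ae_restrict_of_ae h, ae_restrict_mem measurableSet_Ioo] with t ht htm
  obtain ⟨d, hd, hrd⟩ := ht htm
  rwa [hd.deriv]

theorem mul_le_mul_neg_of_slope {m h : ℝ → ℝ} {d s C B : ℝ} (hm : ContinuousAt m s)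
    (hh : HasDerivAt h d s)
    (H : ∀ᶠ t in 𝓝[>] s, C * (t - s) * m t ≤ B * (h s - h t)) : C * m s ≤ B * -d := by
  have h1 : Tendsto (slope h s) (𝓝[>] s) (𝓝 d) :=
    hh.tendsto_slope.mono_left (nhdsWithin_mono _ fun x hx => (ne_of_gt hx))
  have h2 : Tendsto (fun t => C * m t) (𝓝[>] s) (𝓝 (C * m s)) :=
    (hm.tendsto.mono_left nhdsWithin_le_nhds).const_mul C
  refine le_of_tendsto_of_tendsto h2 (h1.neg.const_mul B) ?_
  filter_upwards [H, self_mem_nhdsWithin] with t ht hts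
  have hpos : 0 < t - s := sub_pos.2 hts
  rw [slope_def_field]
  have : B * -((h t - h s) / (t - s)) = B * (h s - h t) / (t - s) := by ring
  rw [this, le_div_iff₀ hpos]
  linarith

variable {ν : Measure ℝ} [IsFiniteMeasure ν] {M p : ℝ}

/-- Layer-cake formula on a bounded interval. -/
theorem integral_mul_primitive {q g : ℝ → ℝ} {a b : ℝ} (hab : a ≤ b)
    (hq : IntegrableOn q (Ioc a b) ν) (hg : IntegrableOn g (Ioc a b)) :
    ∫ x in Ioc a b, q x * (∫ τ in a..x, g τ) ∂ν =
      ∫ τ in a..b, g τ * ∫ x in Ioc τ b, q x ∂ν := by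
  have hprod : Integrable (Function.uncurry fun x τ => (Iio x).indicator (fun τ => q x * g τ) τ)
      ((ν.restrict (Ioc a b)).prod (volume.restrict (Ioc a b))) := by
    have h1 := (Integrable.mul_prod hq hg).indicator
      (measurableSet_lt measurable_snd measurable_fst)
    refine h1.congr (Eventually.of_forall fun z => ?_)
    rfl
  have h := integral_integral_swap hprod
  rw [intervalIntegral.integral_of_le hab]
  have hl : ∫ x in Ioc a b, q x * (∫ τ in a..x, g τ) ∂ν =
      ∫ x in Ioc a b, (∫ τ in Ioc a b, (Iio x).indicator (fun τ => q x * g τ) τ) ∂ν := by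
    refine setIntegral_congr_fun measurableSet_Ioc fun x hx => ?_
    rw [setIntegral_indicator measurableSet_Iio, integral_const_mul,
      intervalIntegral.integral_of_le hx.1.le, ← integral_Ioc_eq_integral_Ioo.symm]
    congr 2
    have : Ioc a b ∩ Iio x = Ioo a x := by
      ext y
      simp only [mem_inter_iff, mem_Ioc, mem_Iio, mem_Ioo]
      exact ⟨fun h => ⟨h.1.1, h.2⟩, fun h => ⟨⟨h.1, h.2.le.trans hx.2⟩, h.2⟩⟩
    rw [this, restrict_Ioo_eq_restrict_Ioc]
  rw [hl, h]
  refine setIntegral_congr_fun measurableSet_Ioc fun τ hτ => ?_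
  have heq : (fun x => (Iio x).indicator (fun τ => q x * g τ) τ) =
      (Ioi τ).indicator fun x => g τ * q x := by
    ext x
    by_cases hx : τ < x
    · rw [indicator_of_mem (show τ ∈ Iio x from hx), indicator_of_mem (show x ∈ Ioi τ from hx),
        mul_comm]
    · rw [indicator_of_notMem (show τ ∉ Iio x from hx),
        indicator_of_notMem (show x ∉ Ioi τ from hx)]
  rw [heq, setIntegral_indicator measurableSet_Ioi, integral_const_mul]
  congr 3
  ext y
  simp only [mem_inter_iff, mem_Ioc, mem_Ioi]
  exact ⟨fun h => ⟨h.2, h.1.2⟩, fun h => ⟨⟨hτ.1.trans h.1, h.2⟩, h.1⟩⟩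

theorem antitone_integral_Ioc {q : ℝ → ℝ} (hq : Continuous q) (hq0 : ∀ x, 0 ≤ q x) :
    Antitone fun t => ∫ x in Ioc t M, q x ∂ν := fun _ _ hst =>
  setIntegral_mono_set hq.integrableOn_Ioc (Eventually.of_forall hq0)
    (Ioc_subset_Ioc_left hst).eventuallyLE

theorem antitone_real_Ioc : Antitone fun t => ν.real (Ioc t M) := fun _ _ hst =>
  measureReal_mono (Ioc_subset_Ioc_left hst)

theorem ae_differentiableAt_of_antitone {f : ℝ → ℝ} (hf : Antitone f) :
    ∀ᵐ x, DifferentiableAt ℝ f x := by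
  filter_upwards [hf.neg.ae_differentiableAt] with x hx
  simpa using hx.neg

theorem integral_Ioc_sub {q : ℝ → ℝ} (hq : Continuous q) {s t : ℝ} (hst : s ≤ t) (htM : t ≤ M) :
    (∫ x in Ioc s M, q x ∂ν) - ∫ x in Ioc t M, q x ∂ν = ∫ x in Ioc s t, q x ∂ν := by
  rw [sub_eq_iff_eq_add, ← setIntegral_union (Ioc_disjoint_Ioc_of_le le_rfl) measurableSet_Ioc
    hq.integrableOn_Ioc hq.integrableOn_Ioc, Ioc_union_Ioc_eq_Ioc hst htM]

theorem real_Ioc_sub {s t : ℝ} (hst : s ≤ t) (htM : t ≤ M) :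
    ν.real (Ioc s M) - ν.real (Ioc t M) = ν.real (Ioc s t) := by
  have := integral_Ioc_sub (ν := ν) (q := fun _ => 1) continuous_const hst htM
  simpa using this

/-- The distribution function of a measure on `(0, M]` satisfies the level-set inequality with
nonlinearity `x ^ p`. -/
def LevelInequality (ν : Measure ℝ) (M p : ℝ) : Prop :=
  ∀ s t, 0 < s → s < t → 4 * π * (t - s) * ν.real (Ioc t M) ≤
    (∫ x in Ioc s M, x ^ p ∂ν) * (ν.real (Ioc s M) - ν.real (Ioc t M))

theorem rpow_le_exp (hp : 0 < p) (hM : 0 < M) {x : ℝ} (hx : 0 ≤ x) :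
    x ^ p ≤ M ^ p * exp (p * (x / M - 1)) := by
  have h1 : x / M ≤ exp (x / M - 1) := by
    have := add_one_le_exp (x / M - 1)
    linarith
  have h2 := rpow_le_rpow (by positivity) h1 hp.le
  rw [div_rpow hx hM.le, ← exp_mul, div_le_iff₀ (by positivity)] at h2
  rw [mul_comm p, mul_comm]
  exact h2

theorem exp_le_rpow (hM : 0 < M) {L x : ℝ} (hL : 0 < L) (hLp : L < p)
    (hx : M * (1 - L / p) < x) (hxM : x ≤ M) :
    exp (-(L ^ 2 / (p - L))) * (M ^ p * exp (p * (x / M - 1))) ≤ x ^ p := by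
  have hp : 0 < p := hL.trans hLp
  have hLp1 : L / p < 1 := (div_lt_one hp).2 hLp
  set y := 1 - x / M with hy
  have hxy : x = M * (1 - y) := by
    rw [hy]
    field_simp
    ring
  have hy0 : 0 ≤ y := sub_nonneg.2 ((div_le_one hM).2 hxM)
  have hyL : y < L / p := by
    have : 1 - L / p < x / M := (lt_div_iff₀ hM).2 (by linarith)
    linarith
  have hy1 : 0 < 1 - y := by linarith
  have hlog := one_sub_inv_le_log_of_pos hy1
  rw [hxy, mul_rpow hM.le hy1.le, mul_left_comm, ← exp_add]
  gcongr
  rw [rpow_def_of_pos hy1]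
  apply exp_le_exp.2
  have h1 : x / M - 1 = -y := by
    rw [hy]
    ring
  rw [← hxy, h1]
  have h2 : y ^ 2 * p / (1 - y) ≤ L ^ 2 / (p - L) := by
    rw [div_le_div_iff₀ hy1 (by linarith)]
    have h3 : y * p < L := (lt_div_iff₀ hp).1 hyL
    nlinarith [mul_nonneg (mul_nonneg hL.le hy1.le) (sub_nonneg.2 h3.le),
      mul_nonneg (mul_nonneg hy0 hp.le) (sub_nonneg.2 h3.le)]
  have h4 : p * (1 - (1 - y)⁻¹) = p * -y - y ^ 2 * p / (1 - y) := by
    field_simp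
    ring
  have h5 := mul_le_mul_of_nonneg_left hlog hp.le
  linarith

theorem LevelInequality.le_energy (h : LevelInequality ν M p) (hM : 0 < M)
    (hpos : ∀ t, 0 ≤ t → t < M → 0 < ν.real (Ioc t M)) {L : ℝ} (hL : 0 < L) (hLp : L < p) :
    8 * π * M ^ 2 * ((1 - L / p) * exp (-(L ^ 2 / (p - L))) * (1 - exp (-(L / 2)))) ≤
      p * ∫ x in Ioc 0 M, x ^ (p + 1) ∂ν := by
  have hp : 0 < p := hL.trans hLp
  set k : ℝ → ℝ := fun x => M ^ p * exp (p * (x / M - 1)) with hk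
  have hkc : Continuous k := by fun_prop
  have hk0 : ∀ x, 0 < k x := fun x => by positivity
  have hkmono : Monotone k := fun x y hxy => by
    simp only [hk]
    gcongr
  set μ : ℝ → ℝ := fun t => ν.real (Ioc t M) with hμ
  have hμa : Antitone μ := antitone_real_Ioc
  have hμ0 : ∀ t, 0 ≤ μ t := fun t => measureReal_nonneg
  set H : ℝ → ℝ := fun t => ∫ x in Ioc t M, k x ∂ν with hH
  have hHa : Antitone H := antitone_integral_Ioc hkc fun x => (hk0 x).le
  have hH0 : ∀ t, 0 ≤ H t := fun t => integral_nonneg fun x => (hk0 x).le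
  have hHM : H M = 0 := by simp [hH]
  have hpc : Continuous fun x : ℝ => x ^ p := Real.continuous_rpow_const hp.le
  have hkH : ∀ s t, s ≤ t → t ≤ M → k s * (μ s - μ t) ≤ H s - H t := by
    intro s t hst htM
    rw [hH, integral_Ioc_sub hkc hst htM, hμ, real_Ioc_sub hst htM]
    have : ∫ _x in Ioc s t, k s ∂ν ≤ ∫ x in Ioc s t, k x ∂ν :=
      setIntegral_mono_on (integrable_const _) hkc.integrableOn_Ioc measurableSet_Ioc
        fun x hx => hkmono hx.1.le
    rwa [setIntegral_const, smul_eq_mul, mul_comm] at this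
  have hderiv : ∀ᵐ t, t ∈ Ioo 0 M → ∃ d, HasDerivAt H d t ∧ 4 * π * (k t * μ t) ≤ H t * -d := by
    filter_upwards [ae_differentiableAt_of_antitone hHa, ae_differentiableAt_of_antitone hμa]
      with s hHs hμs hs
    refine ⟨_, hHs.hasDerivAt, ?_⟩
    rw [← mul_assoc]
    refine mul_le_mul_neg_of_slope hμs.continuousAt hHs.hasDerivAt ?_
    filter_upwards [Ioc_mem_nhdsGT hs.2] with t ht
    have h1 := h s t hs.1 ht.1
    have h2 : ∫ x in Ioc s M, x ^ p ∂ν ≤ H s :=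
      setIntegral_mono_on hpc.integrableOn_Ioc hkc.integrableOn_Ioc measurableSet_Ioc
        fun x hx => rpow_le_exp hp hM (hs.1.trans hx.1).le
    have h3 : 0 ≤ μ s - μ t := sub_nonneg.2 (hμa ht.1.le)
    have h4 : 4 * π * (t - s) * μ t ≤ H s * (μ s - μ t) :=
      h1.trans (mul_le_mul_of_nonneg_right h2 h3)
    calc 4 * π * k s * (t - s) * μ t = k s * (4 * π * (t - s) * μ t) := by ring
      _ ≤ k s * (H s * (μ s - μ t)) := mul_le_mul_of_nonneg_left h4 (hk0 s).le
      _ = H s * (k s * (μ s - μ t)) := by ring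
      _ ≤ H s * (H s - H t) := mul_le_mul_of_nonneg_left (hkH s t ht.1.le ht.2) (hH0 s)
  have hkμ : ∀ a b, IntervalIntegrable (fun t => k t * μ t) volume a b := fun a b =>
    (hμa.intervalIntegrable).continuousOn_mul hkc.continuousOn
  have hsq : ∀ t, 0 ≤ t → t ≤ M → 8 * π * ∫ τ in t..M, k τ * μ τ ≤ H t ^ 2 := by
    intro t ht htM
    have := integral_le_sub_of_monotoneOn (f := fun t => -(H t ^ 2))
      (r := fun τ => 8 * π * (k τ * μ τ)) htM
      (fun x _ y _ hxy => neg_le_neg (pow_le_pow_left₀ (hH0 y) (hHa hxy) 2))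
      ((hkμ t M).const_mul _) ?_
    · rw [intervalIntegral.integral_const_mul, hHM] at this
      linarith
    · filter_upwards [hderiv] with s hs hst
      obtain ⟨d, hd, hle⟩ := hs ⟨ht.trans_lt hst.1, hst.2⟩
      refine ⟨_, (hd.pow 2).neg, ?_⟩
      norm_num
      linarith
  have hlayer : ∀ t, t ≤ M → H t = k t * μ t + p / M * ∫ τ in t..M, k τ * μ τ := by
    intro t htM
    have h1 := integral_mul_primitive (ν := ν) (q := fun _ => 1) (g := fun x => p / M * k x) htM
      (integrable_const _) (Continuous.integrableOn_Ioc (by fun_prop))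
    have hprim : ∀ x, ∫ τ in t..x, p / M * k τ = k x - k t := fun x => by
      refine intervalIntegral.integral_eq_sub_of_hasDerivAt (fun y _ => ?_)
        (Continuous.intervalIntegrable (by fun_prop) _ _)
      have := (((((hasDerivAt_id y).div_const M).sub_const 1).const_mul p).exp).const_mul (M ^ p)
      refine this.congr_deriv ?_
      simp only [hk, id]
      ring
    simp only [hprim, one_mul] at h1
    rw [integral_sub hkc.integrableOn_Ioc (integrable_const _), setIntegral_const] at h1
    simp only [setIntegral_const, smul_eq_mul, mul_one, mul_assoc] at h1
    rw [intervalIntegral.integral_const_mul] at h1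
    simp only [hH, hμ]
    linarith
  set c := p / (8 * π * M) with hc
  have hc0 : 0 < c := by positivity
  have hlow : ∀ t, 0 ≤ t → t ≤ M → H t - c * H t ^ 2 ≤ k t * μ t := by
    intro t ht htM
    have h1 := mul_le_mul_of_nonneg_left (hsq t ht htM) hc0.le
    have h2 : c * (8 * π * ∫ τ in t..M, k τ * μ τ) = p / M * ∫ τ in t..M, k τ * μ τ := by
      rw [hc]
      field_simp
    rw [hlayer t htM] at h1 ⊢
    linarith
  have hHpos : ∀ t, 0 ≤ t → t < M → 0 < H t := by
    intro t ht htM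
    have h1 := hkH t M htM.le le_rfl
    have h2 : μ M = 0 := by simp [hμ]
    rw [h2, hHM, sub_zero, sub_zero] at h1
    exact (mul_pos (hk0 t) (hpos t ht htM)).trans_le h1
  have hmass : ∀ t, 0 ≤ t → t ≤ M → 1 - exp (-(p * (M - t) / (2 * M))) ≤ c * H t := by
    intro t ht htM
    by_contra! hcon
    have hlt : ∀ s, t ≤ s → 0 < 1 - c * H s := fun s hs => by
      have := mul_le_mul_of_nonneg_left (hHa hs) hc0.le
      have := exp_pos (-(p * (M - t) / (2 * M)))
      linarith
    have := integral_le_sub_of_monotoneOn (f := fun t => Real.log (1 - c * H t))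
      (r := fun _ => 4 * π * c) htM
      (fun x hx y _ hxy => log_le_log (hlt x hx.1) (by
        have := mul_le_mul_of_nonneg_left (hHa hxy) hc0.le
        linarith)) (by simp) ?_
    · rw [intervalIntegral.integral_const, hHM] at this
      simp only [smul_eq_mul, mul_zero, sub_zero, Real.log_one, zero_sub] at this
      have h2 : (M - t) * (4 * π * c) = p * (M - t) / (2 * M) := by
        rw [hc]
        field_simp
        ring
      rw [h2] at this
      have h3 : 1 - c * H t ≤ exp (-(p * (M - t) / (2 * M))) := by
        rw [← Real.log_le_iff_le_exp (hlt t le_rfl)]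
        linarith
      linarith
    · filter_upwards [hderiv] with s hs hst
      have hs0 := ht.trans_lt hst.1
      obtain ⟨d, hd, hle⟩ := hs ⟨hs0, hst.2⟩
      have hls := hlt s hst.1.le
      refine ⟨_, ((hd.const_mul c).const_sub 1).log hls.ne', ?_⟩
      rw [le_div_iff₀ hls]
      have h1 := hlow s hs0.le hst.2.le
      have h2 := hHpos s hs0.le hst.2
      have h3 : 4 * π * (H s * (1 - c * H s)) ≤ H s * -d := by
        refine le_trans ?_ hle
        have : H s * (1 - c * H s) ≤ k s * μ s := by linarith
        gcongr
      have h4 : 4 * π * (1 - c * H s) ≤ -d := by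
        refine le_of_mul_le_mul_left ?_ h2
        linarith
      have := mul_le_mul_of_nonneg_left h4 hc0.le
      linarith
  set t := M * (1 - L / p) with ht
  have hLp1 : L / p < 1 := (div_lt_one hp).2 hLp
  have hLp0 : 0 < L / p := by positivity
  have ht0 : 0 < t := mul_pos hM (by linarith)
  have htM : t < M := by nlinarith
  have hm := hmass t ht0.le htM.le
  have he : p * (M - t) / (2 * M) = L / 2 := by
    rw [ht]
    field_simp
    ring
  rw [he] at hm
  have hpc1 : Continuous fun x : ℝ => x ^ (p + 1) := Real.continuous_rpow_const (by linarith)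
  have hE : t * (exp (-(L ^ 2 / (p - L))) * H t) ≤ ∫ x in Ioc 0 M, x ^ (p + 1) ∂ν := by
    calc t * (exp (-(L ^ 2 / (p - L))) * H t)
        = ∫ x in Ioc t M, t * (exp (-(L ^ 2 / (p - L))) * k x) ∂ν := by
          rw [integral_const_mul, integral_const_mul]
      _ ≤ ∫ x in Ioc t M, x ^ (p + 1) ∂ν := by
          refine setIntegral_mono_on (Continuous.integrableOn_Ioc (by fun_prop))
            hpc1.integrableOn_Ioc measurableSet_Ioc fun x hx => ?_
          have hx0 := ht0.trans hx.1
          rw [rpow_add_one hx0.ne', mul_comm]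
          have := exp_le_rpow hM hL hLp hx.1 hx.2
          exact mul_le_mul this hx.1.le ht0.le (by positivity)
      _ ≤ ∫ x in Ioc 0 M, x ^ (p + 1) ∂ν := by
          refine setIntegral_mono_set hpc1.integrableOn_Ioc ?_
            (Ioc_subset_Ioc_left ht0.le).eventuallyLE
          filter_upwards [ae_restrict_mem measurableSet_Ioc] with x hx
          exact rpow_nonneg hx.1.le _
  have hpc8 : p = 8 * π * M * c := by
    rw [hc]
    field_simp
  calc 8 * π * M ^ 2 * ((1 - L / p) * exp (-(L ^ 2 / (p - L))) * (1 - exp (-(L / 2))))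
      = 8 * π * M * (t * exp (-(L ^ 2 / (p - L)))) * (1 - exp (-(L / 2))) := by
        rw [ht]
        ring
    _ ≤ 8 * π * M * (t * exp (-(L ^ 2 / (p - L)))) * (c * H t) := by gcongr
    _ = (8 * π * M * c) * (t * (exp (-(L ^ 2 / (p - L))) * H t)) := by ring
    _ = p * (t * (exp (-(L ^ 2 / (p - L))) * H t)) := by rw [← hpc8]
    _ ≤ p * ∫ x in Ioc 0 M, x ^ (p + 1) ∂ν := by gcongr

theorem integral_Ioc_rpow_pos (hp : 0 ≤ p) {t : ℝ} (ht : 0 ≤ t) (hpos : 0 < ν.real (Ioc t M)) :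
    0 < ∫ x in Ioc t M, x ^ p ∂ν := by
  have hpc : Continuous fun x : ℝ => x ^ p := Real.continuous_rpow_const hp
  rw [setIntegral_pos_iff_support_of_nonneg_ae _ hpc.integrableOn_Ioc]
  · have : (Function.support fun x : ℝ => x ^ p) ∩ Ioc t M = Ioc t M :=
      inter_eq_right.2 fun x hx => (rpow_pos_of_pos (ht.trans_lt hx.1) p).ne'
    rw [this]
    exact (ENNReal.toReal_pos_iff.1 hpos).1
  · filter_upwards [ae_restrict_mem measurableSet_Ioc] with x hx
    exact rpow_nonneg (ht.trans hx.1.le) _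

/-- Gaussian decay of the distribution function in terms of the potential energy. -/
theorem LevelInequality.real_Ioc_le (h : LevelInequality ν M p) (hp : 0 < p) (hM : 0 < M)
    (hpos : ∀ t, 0 ≤ t → t < M → 0 < ν.real (Ioc t M)) {b : ℝ} (hb : 0 ≤ b) (hbM : b < M) :
    ν.real (Ioc b M) ≤
      ν.real (Ioc 0 M) * exp (-(4 * π / (∫ x in Ioc 0 M, x ^ (p + 1) ∂ν) * b ^ 2)) := by
  set μ : ℝ → ℝ := fun t => ν.real (Ioc t M) with hμ
  have hμa : Antitone μ := antitone_real_Ioc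
  set E := ∫ x in Ioc 0 M, x ^ (p + 1) ∂ν with hE
  have hE0 : 0 < E := integral_Ioc_rpow_pos (by linarith) le_rfl (hpos 0 le_rfl hM)
  have hpc : Continuous fun x : ℝ => x ^ p := Real.continuous_rpow_const hp.le
  have hpc1 : Continuous fun x : ℝ => x ^ (p + 1) := Real.continuous_rpow_const (by linarith)
  set F : ℝ → ℝ := fun t => ∫ x in Ioc t M, x ^ p ∂ν with hF
  have hFpos : ∀ t, 0 ≤ t → t < M → 0 < F t := fun t ht htM =>
    integral_Ioc_rpow_pos hp.le ht (hpos t ht htM)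
  have hFa : AntitoneOn F (uIcc 0 b) := by
    rw [uIcc_of_le hb]
    intro s hs t _ hst
    refine setIntegral_mono_set hpc.integrableOn_Ioc ?_ (Ioc_subset_Ioc_left hst).eventuallyLE
    filter_upwards [ae_restrict_mem measurableSet_Ioc] with x hx
    exact rpow_nonneg (hs.1.trans hx.1.le) _
  have hFi : IntervalIntegrable F volume 0 b := hFa.intervalIntegrable
  have hFE : ∫ t in 0..b, F t ≤ E := by
    have h1 := integral_mul_primitive (ν := ν) (q := fun x => x ^ p) (g := fun _ => 1) hM.le
      hpc.integrableOn_Ioc (integrable_const _)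
    have h2 : ∫ x in Ioc 0 M, x ^ p * (∫ _τ in (0 : ℝ)..x, (1 : ℝ)) ∂ν = E := by
      refine setIntegral_congr_fun measurableSet_Ioc fun x hx => ?_
      simp only [intervalIntegral.integral_const, smul_eq_mul, sub_zero, mul_one]
      rw [rpow_add_one hx.1.ne']
    rw [h2] at h1
    simp only [one_mul] at h1
    rw [h1]
    refine intervalIntegral.integral_mono_interval le_rfl hb hbM.le ?_ ?_
    · filter_upwards [ae_restrict_mem measurableSet_Ioc] with t ht
      refine setIntegral_nonneg measurableSet_Ioc fun x hx => ?_
      exact rpow_nonneg (ht.1.le.trans hx.1.le) _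
    · refine AntitoneOn.intervalIntegrable ?_
      rw [uIcc_of_le hM.le]
      intro s hs t _ hst
      refine setIntegral_mono_set hpc.integrableOn_Ioc ?_ (Ioc_subset_Ioc_left hst).eventuallyLE
      filter_upwards [ae_restrict_mem measurableSet_Ioc] with x hx
      exact rpow_nonneg (hs.1.trans hx.1.le) _
  set l := b / E with hl
  have key := integral_le_sub_of_monotoneOn (f := fun t => -Real.log (μ t))
    (r := fun t => 4 * π * (2 * l - l ^ 2 * F t)) hb
    (fun x _ y hy hxy => neg_le_neg (log_le_log (hpos y hy.1 (hy.2.trans_lt hbM)) (hμa hxy)))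
    ((intervalIntegrable_const.sub (hFi.const_mul _)).const_mul _) ?_
  · rw [intervalIntegral.integral_const_mul,
      intervalIntegral.integral_sub intervalIntegrable_const (hFi.const_mul _),
      intervalIntegral.integral_const_mul (l ^ 2), intervalIntegral.integral_const] at key
    have hμ0 := hpos 0 le_rfl hM
    have hμb := hpos b hb hbM
    rw [← Real.log_le_log_iff hμb (by positivity), Real.log_mul hμ0.ne' (exp_pos _).ne',
      Real.log_exp]
    have h1 : l ^ 2 * ∫ t in 0..b, F t ≤ l ^ 2 * E := by gcongr
    have h2 : 4 * π * (2 * l * b - l ^ 2 * E) = 4 * π / E * b ^ 2 := by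
      rw [hl]
      field_simp
      ring
    have h3 : 4 * π * (2 * l * b - l ^ 2 * E) ≤ 4 * π * (2 * l * b - l ^ 2 * ∫ t in 0..b, F t) := by
      gcongr
    simp only [smul_eq_mul, sub_zero] at key
    rw [mul_comm b] at key
    simp only [hμ] at key
    linarith
  · filter_upwards [ae_differentiableAt_of_antitone hμa] with s hs hsb
    have hsM := hsb.2.trans hbM
    have hμs := hpos s hsb.1.le hsM
    refine ⟨_, (hs.hasDerivAt.log hμs.ne').neg, ?_⟩
    have h1 : 4 * π * μ s ≤ F s * -deriv μ s := by
      refine mul_le_mul_neg_of_slope hs.continuousAt hs.hasDerivAt ?_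
      filter_upwards [self_mem_nhdsWithin] with t ht
      exact h s t hsb.1 ht
    have h2 := hFpos s hsb.1.le hsM
    have h3 : 4 * π / F s ≤ -(deriv μ s / μ s) := by
      rw [← neg_div, div_le_div_iff₀ h2 hμs]
      linarith
    refine le_trans ?_ h3
    rw [le_div_iff₀ h2]
    have h4 : 0 ≤ 4 * π * (1 - l * F s) ^ 2 := by positivity
    linarith

/-- Exponential integrability at a subcritical Gaussian exponent. -/
theorem LevelInequality.integral_exp_sq_le (h : LevelInequality ν M p) (hp : 0 < p) (hM : 0 < M)
    (hpos : ∀ t, 0 ≤ t → t < M → 0 < ν.real (Ioc t M)) {δ : ℝ} (hδ : 0 < δ) (hδ1 : δ < 1) :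
    ∫ x in Ioc 0 M, exp ((1 - δ) * (4 * π / ∫ x in Ioc 0 M, x ^ (p + 1) ∂ν) * x ^ 2) ∂ν ≤
      ν.real (Ioc 0 M) / δ := by
  have hE0 : 0 < ∫ x in Ioc 0 M, x ^ (p + 1) ∂ν :=
    integral_Ioc_rpow_pos (by linarith) le_rfl (hpos 0 le_rfl hM)
  have hdecay := fun b hb hbM => h.real_Ioc_le hp hM hpos (b := b) hb hbM
  set γ := 4 * π / ∫ x in Ioc 0 M, x ^ (p + 1) ∂ν with hγ
  have hγ0 : 0 < γ := by positivity
  set V := ν.real (Ioc 0 M) with hV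
  have hV0 : 0 ≤ V := measureReal_nonneg
  set β := (1 - δ) * γ with hβ
  have hβ0 : 0 < β := mul_pos (by linarith) hγ0
  have hgauss : ∀ c x : ℝ,
      HasDerivAt (fun x => exp (c * x ^ 2)) (2 * c * x * exp (c * x ^ 2)) x := by
    intro c x
    have := (((hasDerivAt_id x).pow 2).const_mul c).exp
    refine this.congr_deriv ?_
    simp
    ring
  have hprim : ∀ c a : ℝ, ∫ x in 0..a, 2 * c * x * exp (c * x ^ 2) = exp (c * a ^ 2) - 1 := by
    intro c a
    rw [intervalIntegral.integral_eq_sub_of_hasDerivAt (fun x _ => hgauss c x)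
      (Continuous.intervalIntegrable (by fun_prop) _ _)]
    simp
  have h1 := integral_mul_primitive (ν := ν) (q := fun _ => 1)
    (g := fun x => 2 * β * x * exp (β * x ^ 2)) hM.le
    (integrable_const _) (Continuous.integrableOn_Ioc (by fun_prop))
  simp only [hprim, one_mul] at h1
  rw [integral_sub (Continuous.integrableOn_Ioc (by fun_prop)) (integrable_const _)] at h1
  simp only [setIntegral_const, smul_eq_mul, mul_one] at h1
  have hμa : Antitone fun t => ν.real (Ioc t M) := antitone_real_Ioc
  have h2 : ∫ τ in 0..M, 2 * β * τ * exp (β * τ ^ 2) * ν.real (Ioc τ M) ≤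
      ∫ τ in 0..M, V * ((1 - δ) / δ) * -(2 * (-(δ * γ)) * τ * exp (-(δ * γ) * τ ^ 2)) := by
    refine intervalIntegral.integral_mono_on_of_le_Ioo hM.le
      (hμa.intervalIntegrable.continuousOn_mul (Continuous.continuousOn (by fun_prop)))
      (Continuous.intervalIntegrable (by fun_prop) _ _) fun τ hτ => ?_
    have h3 := hdecay τ hτ.1.le hτ.2
    have hτ0 := hτ.1
    calc 2 * β * τ * exp (β * τ ^ 2) * ν.real (Ioc τ M)
        ≤ 2 * β * τ * exp (β * τ ^ 2) * (V * exp (-(γ * τ ^ 2))) := by gcongr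
      _ = 2 * β * τ * V * (exp (β * τ ^ 2) * exp (-(γ * τ ^ 2))) := by ring
      _ = 2 * β * τ * V * exp (-(δ * γ) * τ ^ 2) := by
        rw [← exp_add]
        congr 2
        rw [hβ]
        ring
      _ = V * ((1 - δ) / δ) * -(2 * (-(δ * γ)) * τ * exp (-(δ * γ) * τ ^ 2)) := by
        rw [hβ]
        field_simp
  rw [intervalIntegral.integral_const_mul, intervalIntegral.integral_neg, hprim] at h2
  have h4 : V * ((1 - δ) / δ) * -(exp (-(δ * γ) * M ^ 2) - 1) ≤ V * ((1 - δ) / δ) * 1 := by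
    have := exp_pos (-(δ * γ) * M ^ 2)
    have : 0 ≤ (1 - δ) / δ := div_nonneg (by linarith) hδ.le
    gcongr
    linarith
  have h5 : V * ((1 - δ) / δ) * 1 = V / δ - V := by
    field_simp
  change _ - V = _ at h1
  linarith

theorem rpow_le_gaussian {q β x : ℝ} (hq : 0 < q) (hβ : 0 < β) (hx : 0 < x) :
    x ^ q ≤ (q / (2 * exp 1 * β)) ^ (q / 2) * exp (β * x ^ 2) := by
  have h1 : 2 * β * x ^ 2 / q ≤ exp (2 * β * x ^ 2 / q - 1) := by
    have := add_one_le_exp (2 * β * x ^ 2 / q - 1)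
    linarith
  have h2 : x ^ 2 ≤ q / (2 * exp 1 * β) * exp (2 * β * x ^ 2 / q) := by
    rw [exp_sub, le_div_iff₀ (exp_pos _)] at h1
    calc x ^ 2 = q / (2 * exp 1 * β) * (2 * β * x ^ 2 / q * exp 1) := by field_simp
      _ ≤ _ := by gcongr
  have h3 := rpow_le_rpow (by positivity) h2 (show 0 ≤ q / 2 by positivity)
  rw [mul_rpow (by positivity) (by positivity), ← exp_mul, ← rpow_natCast, ← rpow_mul hx.le] at h3
  have h4 : ((2 : ℕ) : ℝ) * (q / 2) = q := by
    push_cast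
    ring
  have h5 : 2 * β * x ^ ((2 : ℕ) : ℝ) / q * (q / 2) = β * x ^ 2 := by
    rw [rpow_natCast]
    field_simp
  rwa [h4, h5] at h3

/-- Universal lower bound for the potential energy. -/
theorem LevelInequality.lt_energy (h : LevelInequality ν M p) (hp : 1 < p) (hM : 0 < M)
    (hpos : ∀ t, 0 ≤ t → t < M → 0 < ν.real (Ioc t M)) {δ V : ℝ} (hδ : 0 < δ) (hδ1 : δ < 1)
    (hV : ν.real (Ioc 0 M) ≤ V)
    (hlarge : (p + 1) * (1 - δ) ^ ((p - 1) / 2) * V < 8 * π * exp 1 * δ * (1 - δ)) :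
    8 * π * exp 1 * (1 - δ) ^ 2 < (p + 1) * ∫ x in Ioc 0 M, x ^ (p + 1) ∂ν := by
  have hE0 : 0 < ∫ x in Ioc 0 M, x ^ (p + 1) ∂ν :=
    integral_Ioc_rpow_pos (by linarith) le_rfl (hpos 0 le_rfl hM)
  have hexp := h.integral_exp_sq_le (by linarith) hM hpos hδ hδ1
  have hpc1 : Continuous fun x : ℝ => x ^ (p + 1) := Real.continuous_rpow_const (by linarith)
  have hcmp : ∀ β > 0, ∫ x in Ioc 0 M, x ^ (p + 1) ∂ν ≤
      ((p + 1) / (2 * exp 1 * β)) ^ ((p + 1) / 2) * ∫ x in Ioc 0 M, exp (β * x ^ 2) ∂ν := by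
    intro β hβ
    rw [← integral_const_mul]
    exact setIntegral_mono_on hpc1.integrableOn_Ioc (Continuous.integrableOn_Ioc (by fun_prop))
      measurableSet_Ioc fun x hx => rpow_le_gaussian (by linarith) hβ hx.1
  set E := ∫ x in Ioc 0 M, x ^ (p + 1) ∂ν with hE
  have hδ' : 0 < 1 - δ := by linarith
  by_contra! hcon
  have hE1 := hcmp ((1 - δ) * (4 * π / E)) (by positivity)
  have hV0 : 0 ≤ V := measureReal_nonneg.trans hV
  set X := (p + 1) * E / (8 * π * exp 1) with hX
  have hX0 : 0 < X := by positivity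
  have hXδ : X / (1 - δ) ≤ 1 - δ := by
    rw [div_le_iff₀ hδ', hX, div_le_iff₀ (by positivity)]
    linarith
  have hbase : (p + 1) / (2 * exp 1 * ((1 - δ) * (4 * π / E))) = X / (1 - δ) := by
    rw [hX]
    field_simp
    ring
  rw [hbase] at hE1
  have hpow : (X / (1 - δ)) ^ ((p + 1) / 2) ≤ (1 - δ) ^ ((p - 1) / 2) * (X / (1 - δ)) := by
    have : (p + 1) / 2 = (p - 1) / 2 + 1 := by ring
    rw [this, rpow_add_one (by positivity)]
    gcongr
  have hfin : E ≤ (1 - δ) ^ ((p - 1) / 2) * (X / (1 - δ)) * (V / δ) := by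
    refine hE1.trans ?_
    have : ∫ x in Ioc 0 M, exp ((1 - δ) * (4 * π / E) * x ^ 2) ∂ν ≤ V / δ := by
      refine hexp.trans ?_
      gcongr
    gcongr
  have hcalc : (1 - δ) ^ ((p - 1) / 2) * (X / (1 - δ)) * (V / δ) =
      (p + 1) * (1 - δ) ^ ((p - 1) / 2) * V * (E / (8 * π * exp 1 * δ * (1 - δ))) := by
    rw [hX]
    field_simp
  rw [hcalc] at hfin
  have hlt : (p + 1) * (1 - δ) ^ ((p - 1) / 2) * V * (E / (8 * π * exp 1 * δ * (1 - δ))) <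
      8 * π * exp 1 * δ * (1 - δ) * (E / (8 * π * exp 1 * δ * (1 - δ))) := by
    gcongr
  have hE2 : 8 * π * exp 1 * δ * (1 - δ) * (E / (8 * π * exp 1 * δ * (1 - δ))) = E := by
    field_simp
  linarith

end LevelFunctions

section OneSided

variable {Ω : Set R2} {u : R2 → ℝ} {p : ℝ}

theorem exists_level_measure (hp : 1 < p) (hb : Bornology.IsBounded Ω) (hop : IsOpen Ω)
    (hu2 : ContDiffOn ℝ 2 u Ω) (huc : ContinuousOn u (closure Ω))
    (heq : ∀ x ∈ Ω, -lap u x = |u x| ^ (p - 1) * u x) (h0 : ∀ x ∈ frontier Ω, u x = 0)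
    {x₀ : R2} (hx₀ : x₀ ∈ Ω) (hmax : ∀ x ∈ Ω, u x ≤ u x₀)
    (hgi : IntegrableOn (fun x => ‖fderiv ℝ u x‖ ^ 2) Ω) :
    ∃ ν : Measure ℝ, IsFiniteMeasure ν ∧ LevelInequality ν (u x₀) p ∧
      (∀ t, 0 ≤ t → t < u x₀ → 0 < ν.real (Ioc t (u x₀))) ∧
      ν.real (Ioc 0 (u x₀)) ≤ volume.real Ω ∧
      ∫ x in Ioc 0 (u x₀), x ^ (p + 1) ∂ν ≤ ∫ x in {x ∈ Ω | 0 < u x}, ‖fderiv ℝ u x‖ ^ 2 := by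
  have huΩ : ContinuousOn u Ω := huc.mono subset_closure
  have hum : AEMeasurable u (volume.restrict Ω) := huΩ.aemeasurable hop.measurableSet
  have hopen : ∀ r, IsOpen {x ∈ Ω | r < u x} := fun r =>
    huΩ.isOpen_inter_preimage hop isOpen_Ioi
  have hfin : volume Ω ≠ ⊤ := hb.measure_lt_top.ne
  have : IsFiniteMeasure (volume.restrict Ω) := ⟨by
    rw [Measure.restrict_apply_univ]
    exact hb.measure_lt_top⟩
  have hpre : ∀ t, u ⁻¹' Ioc t (u x₀) ∩ Ω = {x ∈ Ω | t < u x} := by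
    intro t
    ext x
    exact ⟨fun h => ⟨h.2, h.1.1⟩, fun h => ⟨⟨h.2, hmax x h.1⟩, h.1⟩⟩
  set ν := Measure.map u (volume.restrict Ω) with hν
  have hνr : ∀ t, ν.real (Ioc t (u x₀)) = volume.real {x ∈ Ω | t < u x} := by
    intro t
    rw [measureReal_def, hν, Measure.map_apply_of_aemeasurable hum measurableSet_Ioc,
      Measure.restrict_apply' hop.measurableSet, hpre, measureReal_def]
  have hνi : ∀ t, ∀ f : ℝ → ℝ, Continuous f →
      ∫ x in Ioc t (u x₀), f x ∂ν = ∫ x in {x ∈ Ω | t < u x}, f (u x) := by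
    intro t f hf
    rw [hν, setIntegral_map measurableSet_Ioc hf.aestronglyMeasurable hum,
      Measure.restrict_restrict' hop.measurableSet, hpre]
  have hrpow : ∀ y : ℝ, 0 < y → |y| ^ (p - 1) * y = y ^ p := by
    intro y hy
    rw [abs_of_pos hy, ← rpow_add_one hy.ne', sub_add_cancel]
  refine ⟨ν, inferInstance, fun s t hs hst => ?_, fun t _ htM => ?_, ?_, ?_⟩
  · rw [hνr, hνr, hνi s _ (Real.continuous_rpow_const (by linarith))]
    have := level_inequality hp hb hop hu2 huc heq h0 hs hst
    rwa [setIntegral_congr_fun (hopen s).measurableSet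
      fun x hx => hrpow (u x) (hs.trans hx.2)] at this
  · rw [hνr]
    refine ENNReal.toReal_pos ((hopen t).measure_pos volume ⟨x₀, hx₀, htM⟩).ne' ?_
    exact measure_ne_top_of_subset (fun x hx => hx.1) hfin
  · rw [hνr]
    exact measureReal_mono (fun x hx => hx.1) hfin
  · rw [hνi 0 _ (Real.continuous_rpow_const (by linarith))]
    refine le_trans (le_of_eq ?_) (integral_pos_part_le hp hb hop hu2 huc heq h0 hmax hgi)
    refine setIntegral_congr_fun (hopen 0).measurableSet fun x hx => ?_
    rw [hrpow _ hx.2, rpow_add_one hx.2.ne']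

theorem lap_neg (u : R2 → ℝ) (x : R2) : lap (fun y => -u y) x = -lap u x := by
  simp only [lap, fderiv_fun_neg, neg_apply, Finset.sum_neg_distrib]

theorem norm_gradient (u : R2 → ℝ) (x : R2) : ‖gradient u x‖ = ‖fderiv ℝ u x‖ := by
  simp [gradient]

end OneSided

section Asymptotics

theorem eventually_rpow_lt {δ : ℝ} (hδ : 0 < δ) (hδ1 : δ < 1) (V : ℝ) {c : ℝ} (hc : 0 < c) :
    ∀ᶠ p : ℝ in atTop, (p + 1) * (1 - δ) ^ ((p - 1) / 2) * V < c := by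
  have hδ' : 0 < 1 - δ := by linarith
  set b := -Real.log (1 - δ) / 2 with hb
  have hb0 : 0 < b := by
    have := Real.log_neg hδ' (by linarith)
    rw [hb]
    linarith
  have h1 := ((tendsto_rpow_mul_exp_neg_mul_atTop_nhds_zero 1 b hb0).comp
    (tendsto_atTop_add_const_right atTop (1 : ℝ) tendsto_id)).mul_const ((1 - δ)⁻¹ * V)
  rw [zero_mul] at h1
  filter_upwards [h1.eventually_lt_const hc] with p hp
  refine lt_of_eq_of_lt ?_ hp
  simp only [Function.comp_apply, id, rpow_one]
  have h2 : (p - 1) / 2 = (p + 1) / 2 - 1 := by ring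
  have h3 : -b * (p + 1) = Real.log (1 - δ) * ((p + 1) / 2) := by
    rw [hb]
    ring
  rw [h2, rpow_sub_one hδ'.ne', rpow_def_of_pos hδ', h3]
  ring

theorem exists_parameters {ε : ℝ} (hε : 0 < ε) : ∃ δ L : ℝ, 0 < δ ∧ δ < 1 ∧ 0 < L ∧
    exp 1 * (2 - (1 - δ) ^ 2) < (exp (1 / 2) + ε) ^ 2 * (1 - exp (-(L / 2))) := by
  have hlt : exp 1 < (exp (1 / 2) + ε) ^ 2 := by
    have : exp 1 = exp (1 / 2) ^ 2 := by
      rw [← exp_nat_mul]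
      norm_num
    rw [this]
    have := exp_pos (1 / 2)
    gcongr
    linarith
  have h1 : Tendsto (fun L : ℝ => exp 1 * (2 - (1 - L⁻¹) ^ 2)) atTop
      (𝓝 (exp 1 * (2 - (1 - 0) ^ 2))) :=
    (((tendsto_inv_atTop_zero.const_sub 1).pow 2).const_sub 2).const_mul _
  have h2 : Tendsto (fun L : ℝ => (exp (1 / 2) + ε) ^ 2 * (1 - exp (-(L / 2)))) atTop
      (𝓝 ((exp (1 / 2) + ε) ^ 2 * (1 - 0))) :=
    ((tendsto_exp_neg_atTop_nhds_zero.comp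
      (tendsto_id.atTop_div_const two_pos)).const_sub 1).const_mul _
  obtain ⟨L, hL, hL1⟩ := ((h1.eventually_lt h2 (by norm_num; linarith)).and
    (eventually_gt_atTop 1)).exists
  exact ⟨L⁻¹, L, by positivity, inv_lt_one_of_one_lt₀ hL1, by linarith, hL⟩

theorem eventually_energy_gap {A : ℝ → ℝ} (hA : Tendsto A atTop (𝓝 (16 * π * exp 1)))
    {δ L K : ℝ} (h : exp 1 * (2 - (1 - δ) ^ 2) < K ^ 2 * (1 - exp (-(L / 2)))) :
    ∀ᶠ p : ℝ in atTop, A p - 8 * π * exp 1 * (1 - δ) ^ 2 * (p / (p + 1)) <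
      8 * π * K ^ 2 * ((1 - L / p) * exp (-(L ^ 2 / (p - L))) * (1 - exp (-(L / 2)))) := by
  have h1 : Tendsto (fun p : ℝ => p / (p + 1)) atTop (𝓝 1) := by
    have : Tendsto (fun p : ℝ => 1 - (p + 1)⁻¹) atTop (𝓝 (1 - 0)) :=
      (tendsto_inv_atTop_zero.comp
        (tendsto_atTop_add_const_right atTop (1 : ℝ) tendsto_id)).const_sub 1
    rw [sub_zero] at this
    refine this.congr' ?_
    filter_upwards [eventually_gt_atTop 0] with p hp
    field_simp
    ring
  have h2 : Tendsto (fun p : ℝ => 1 - L / p) atTop (𝓝 (1 - 0)) :=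
    (tendsto_const_nhds.div_atTop tendsto_id).const_sub 1
  have h3 : Tendsto (fun p : ℝ => exp (-(L ^ 2 / (p - L)))) atTop (𝓝 (exp (-0))) :=
    (continuous_exp.tendsto _).comp ((tendsto_const_nhds.div_atTop
      (tendsto_atTop_add_const_right atTop (-L) tendsto_id)).neg)
  have h4 := (hA.sub (h1.const_mul (8 * π * exp 1 * (1 - δ) ^ 2))).eventually_lt
    (((h2.mul h3).mul_const (1 - exp (-(L / 2)))).const_mul (8 * π * K ^ 2)) ?_
  · exact h4
  · have := pi_pos
    simp only [neg_zero, exp_zero, sub_zero, mul_one, one_mul]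
    nlinarith

theorem le_of_energy_gap {p M K G G' T w e : ℝ} (hp : 0 < p) (hK : 0 ≤ K) (hw : 0 < w)
    (hM : 8 * π * M ^ 2 * w ≤ p * G) (hG' : e ≤ (p + 1) * G') (hT : G + G' ≤ T)
    (hgap : p * T - e * (p / (p + 1)) < 8 * π * K ^ 2 * w) : M ≤ K := by
  have h1 : e * (p / (p + 1)) ≤ p * G' := by
    rw [← mul_div_assoc, div_le_iff₀ (by linarith)]
    nlinarith
  have h2 : p * (G + G') ≤ p * T := by gcongr
  have h3 : M ^ 2 * (8 * π * w) < K ^ 2 * (8 * π * w) := by linarith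
  exact (lt_of_pow_lt_pow_left₀ 2 hK (lt_of_mul_lt_mul_right h3 (by positivity))).le

end Asymptotics

theorem stmt15
    (Ω : Set R2) (hne : Ω.Nonempty) (hop : IsOpen Ω)
    (hbdd : Bornology.IsBounded Ω) (hconn : IsConnected Ω) (hsm : SmoothBoundary Ω)
    (u : ℝ → R2 → ℝ)
    (hsol : ∀ p > (1:ℝ), IsSolution Ω p (u p))
    (hnod : ∀ p > (1:ℝ), IsNodal Ω (u p))
    (xp xm : ℝ → R2)
    (hxpmem : ∀ p > (1:ℝ), xp p ∈ Ω)
    (hxpmax : ∀ p > (1:ℝ), ∀ x ∈ Ω, u p x ≤ u p (xp p))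
    (hxmmem : ∀ p > (1:ℝ), xm p ∈ Ω)
    (hxmmin : ∀ p > (1:ℝ), ∀ x ∈ Ω, u p (xm p) ≤ u p x)
    (hcomp : ∀ p > (1:ℝ), -u p (xm p) ≤ u p (xp p))
    (hA : CondA Ω u) :
    (∀ ε > (0:ℝ), ∀ᶠ p : ℝ in atTop, u p (xp p) ≤ Real.exp (1 / 2) + ε) ∧
    (∀ ε > (0:ℝ), ∀ᶠ p : ℝ in atTop, -u p (xm p) ≤ Real.exp (1 / 2) + ε) := by
  have heq : ∀ p > (1 : ℝ), ∀ x ∈ Ω, -lap (u p) x = |u p x| ^ (p - 1) * u p x :=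
    fun p hp => (hsol p hp).2.2.1
  have heq' : ∀ p > (1 : ℝ), ∀ x ∈ Ω,
      -lap (fun y => -u p y) x = |-u p x| ^ (p - 1) * -u p x := by
    intro p hp x hx
    rw [lap_neg, abs_neg, heq p hp x hx, mul_neg]
  have hgrad : ∀ (p : ℝ) x, ‖fderiv ℝ (fun y => -u p y) x‖ ^ 2 = ‖fderiv ℝ (u p) x‖ ^ 2 := by
    intro p x
    rw [fderiv_fun_neg, norm_neg]
  have hboth : ∀ ε > (0 : ℝ), ∀ᶠ p : ℝ in atTop,
      u p (xp p) ≤ Real.exp (1 / 2) + ε ∧ -u p (xm p) ≤ Real.exp (1 / 2) + ε := by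
    intro ε hε
    obtain ⟨δ, L, hδ, hδ1, hL, hpar⟩ := exists_parameters hε
    have hA0 : ∀ᶠ p : ℝ in atTop, p * ∫ x in Ω, ‖gradient (u p) x‖ ^ 2 ≠ 0 :=
      hA.eventually_ne (by positivity)
    filter_upwards [hA0, eventually_energy_gap hA hpar, eventually_gt_atTop L,
      eventually_gt_atTop 1, eventually_rpow_lt hδ hδ1 (volume.real Ω)
        (show 0 < 8 * π * Real.exp 1 * δ * (1 - δ) from
          mul_pos (by positivity) (by linarith))] with p hne0 hgap hLp hp hlarge
    simp only [norm_gradient] at hne0 hgap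
    have hp0 : 0 < p := by linarith
    obtain ⟨hu2, hu1, -, h0⟩ := hsol p hp
    have huc := hu1.continuousOn
    have huΩ : ContinuousOn (u p) Ω := huc.mono subset_closure
    obtain ⟨⟨y, hy, hypos⟩, z, hz, hzneg⟩ := hnod p hp
    have hMp : 0 < u p (xp p) := hypos.trans_le (hxpmax p hp y hy)
    have hMm : 0 < -u p (xm p) := by
      have := hxmmin p hp z hz
      linarith
    have hgi : IntegrableOn (fun x => ‖fderiv ℝ (u p) x‖ ^ 2) Ω := by
      by_contra hcon
      exact hne0 (by rw [integral_undef hcon, mul_zero])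
    obtain ⟨ν, _, hlev, hpos, hV, hE⟩ := exists_level_measure hp hbdd hop hu2 huc (heq p hp) h0
      (hxpmem p hp) (hxpmax p hp) hgi
    obtain ⟨ν', _, hlev', hpos', hV', hE'⟩ := exists_level_measure hp hbdd hop hu2.neg huc.neg
      (heq' p hp) (fun x hx => by rw [h0 x hx, neg_zero])
      (hxmmem p hp) (fun x hx => neg_le_neg (hxmmin p hp x hx)) (by simpa only [hgrad] using hgi)
    simp only [hgrad] at hE'
    set G := ∫ x in {x ∈ Ω | 0 < u p x}, ‖fderiv ℝ (u p) x‖ ^ 2 with hG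
    set G' := ∫ x in {x ∈ Ω | 0 < -u p x}, ‖fderiv ℝ (u p) x‖ ^ 2 with hG'
    have hGG : G + G' ≤ ∫ x in Ω, ‖fderiv ℝ (u p) x‖ ^ 2 := by
      have hm' : MeasurableSet {x ∈ Ω | 0 < -u p x} :=
        (huΩ.neg.isOpen_inter_preimage hop isOpen_Ioi).measurableSet
      rw [hG, hG', ← setIntegral_union (disjoint_left.2 fun x hx hx' => by
        have h1 : 0 < u p x := hx.2
        have h2 : 0 < -u p x := hx'.2
        linarith) hm' (hgi.mono_set fun x hx => hx.1) (hgi.mono_set fun x hx => hx.1)]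
      exact setIntegral_mono_set hgi (Eventually.of_forall fun x => by positivity)
        (union_subset (fun x hx => hx.1) fun x hx => hx.1).eventuallyLE
    have hw : 0 < (1 - L / p) * Real.exp (-(L ^ 2 / (p - L))) * (1 - Real.exp (-(L / 2))) := by
      have h1 : L / p < 1 := (div_lt_one hp0).2 hLp
      have h2 : Real.exp (-(L / 2)) < 1 := Real.exp_lt_one_iff.2 (by linarith)
      exact mul_pos (mul_pos (by linarith) (exp_pos _)) (by linarith)
    have hK : 0 ≤ Real.exp (1 / 2) + ε := by positivity
    have hp1 : 0 ≤ p + 1 := by linarith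
    exact ⟨le_of_energy_gap hp0 hK hw
        ((hlev.le_energy hMp hpos hL hLp).trans (mul_le_mul_of_nonneg_left hE hp0.le))
        ((hlev'.lt_energy hp hMm hpos' hδ hδ1 hV' hlarge).le.trans
          (mul_le_mul_of_nonneg_left hE' hp1)) hGG hgap,
      le_of_energy_gap hp0 hK hw
        ((hlev'.le_energy hMm hpos' hL hLp).trans (mul_le_mul_of_nonneg_left hE' hp0.le))
        ((hlev.lt_energy hp hMp hpos hδ hδ1 hV hlarge).le.trans
          (mul_le_mul_of_nonneg_left hE hp1)) (by rwa [add_comm]) hgap⟩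
  exact ⟨fun ε hε => (hboth ε hε).mono fun _ h => h.1,
    fun ε hε => (hboth ε hε).mono fun _ h => h.2⟩
end
end
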